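/- The least constant c such that every n-vertex graph with more than c·n edges contains a cycle whose length is congruent to 2 modulo 4 equals 5/2. Concretely: every n-vertex graph with at least (5/2)(n−1)+1 edges contains a cycle of length ≡ 2 (mod 4), and for infinitely many n there exist n-vertex graphs with (5/2)(n−1) edges and no cycle of length ≡ 2 (mod 4). -/

import Mathlib

open SimpleGraph

namespace C24

/-- A link `(a, b, c)`: a path between marks `a` and `b`; `c = 5` means an edge, otherwise the
length is congruent to `c` modulo 4. -/
abbrev Link := ℕ × ℕ × ℕ

structure St where
  n : ℕ
  L : List Link
  C : List ℕ

inductive Op where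
  | R (s : List ℕ)
  | X (p : List ℕ)
  | S (k i : ℕ)
  | N (p : List ℕ)

def memb (a : ℕ) (l : List ℕ) : Bool :=
  List.rec (motive := fun _ => Bool) false
    (fun b _ ih => Bool.rec (motive := fun _ => Bool) ih true (Nat.beq a b)) l

/-- `cond` through the recursor. -/
def br {α : Type} (b : Bool) (t e : α) : α := Bool.rec e t b

/-- Evaluate a number before passing it on (helps kernel evaluation). -/
def fN {α : Type} (n : ℕ) (k : ℕ → α) : α :=
  Nat.rec (k 0) (fun m _ => k (Nat.succ m)) n

/-- Evaluate a list of links before passing it on (helps kernel evaluation). -/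
def fL {α : Type} (L : List Link) (k : List Link → α) : α :=
  List.rec (motive := fun _ => (List Link → α) → α) (fun k => k [])
    (fun l _ ih k => ih fun L' => fN l.1 fun a => fN l.2.1 fun b => fN l.2.2 fun c =>
      k ((a, b, c) :: L')) L k

def anyL (p : Link → Bool) (L : List Link) : Bool :=
  List.rec (motive := fun _ => Bool) false
    (fun l _ ih => Bool.rec (motive := fun _ => Bool) ih true (p l)) L

/-- Split the links into those at `cur` (as pairs (other end, length)) and the others. -/
def part (cur : ℕ) (L : List Link) : List (ℕ × ℕ) → List Link → (List (ℕ × ℕ) → List Link → Bool) → Bool :=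
  List.rec (motive := fun _ => List (ℕ × ℕ) → List Link → (List (ℕ × ℕ) → List Link → Bool) → Bool)
    (fun I R k => k I R)
    (fun l _ ih I R k => Prod.rec (motive := fun _ => Bool) (fun a bc => 
        Prod.rec (motive := fun _ => Bool) (fun b c =>
        Bool.rec (motive := fun _ => Bool) 
          (Bool.rec (motive := fun _ => Bool) 
            (ih I (l :: R) k)
            (ih ((a, c) :: I) R k)
            (Nat.beq b cur))
          (ih ((b, c) :: I) R k)
          (Nat.beq a cur)) bc) l) L

/-- Depth first search for a path from `cur` to `tgt` with length `need` modulo 4. -/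
def dfs (tgt f : ℕ) : List Link → ℕ → ℕ → Bool :=
  Nat.rec (motive := fun _ => List Link → ℕ → ℕ → Bool) (fun _ _ _ => false)
    (fun _ ih L cur need =>
      Bool.rec (motive := fun _ => Bool)
      (part cur L [] [] fun I R =>
        List.rec (motive := fun _ => Bool) false
         (fun p _ ih2 => Bool.rec (motive := fun _ => Bool) ih2 true
            (Prod.rec (motive := fun _ => Bool) (fun z c => 
              fN (Nat.mod (Nat.sub (Nat.add need 8) c) 4) fun m => ih R z m) p)) I)
      (Nat.beq need 0)
      (Nat.beq cur tgt)) f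

def killed (n : ℕ) (L : List Link) (a b r : ℕ) : Bool :=
  dfs b (n + 1) L a ((6 - r) % 4)

def exactL (L : List Link) (i j : ℕ) : Bool :=
  L.any fun l => Nat.beq l.2.2 5 &&
    ((Nat.beq l.1 i && Nat.beq l.2.1 j) || (Nat.beq l.1 j && Nat.beq l.2.1 i))

def splitL (n : ℕ) (L : List Link) (k : ℕ) (l : Link) (r : ℕ) : List Link :=
  (l.1, n, r) :: (n, l.2.1, (l.2.2 + 4 - r) % 4) :: L.eraseIdx k

def targets (st : St) (i : ℕ) : List St :=
  ((List.range st.n).flatMap fun j =>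
    bif Nat.beq j i || memb j st.C || exactL st.L i j || killed st.n st.L i j 1 then []
    else [⟨st.n, (i, j, 5) :: st.L, st.C⟩]) ++
  ((List.range st.L.length).flatMap fun k =>
    match st.L[k]? with
    | none => []
    | some l =>
      bif Nat.beq l.2.2 5 then []
      else [0, 1, 2, 3].flatMap fun r =>
        fL (splitL st.n st.L k l r) fun L' =>
        bif killed (st.n + 1) L' i st.n 1 then []
        else [⟨st.n + 1, (i, st.n, 5) :: L', st.C⟩])

def degL (L : List Link) (i : ℕ) : ℕ :=
  (L.map fun l => (bif Nat.beq l.1 i then 1 else 0) + (bif Nat.beq l.2.1 i then 1 else 0)).sum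

def costL (L : List Link) (s : List ℕ) : ℕ :=
  (L.map fun l =>
    bif Nat.beq l.2.2 5 then (bif memb l.1 s || memb l.2.1 s then 1 else 0)
    else (bif memb l.1 s then 1 else 0) + (bif memb l.2.1 s then 1 else 0)).sum

def nodupB : List ℕ → Bool
  | [] => true
  | a :: l => !(memb a l) && nodupB l

def redu (st : St) (s : List ℕ) : Bool :=
  nodupB s && Nat.blt 0 s.length && s.all (fun i => memb i st.C && Nat.blt 0 i) &&
    Nat.ble (2 * costL st.L s) (5 * s.length)

def takeGen (a b : ℕ) : List Link → Option (List Link)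
  | [] => none
  | l :: L =>
    bif !(Nat.beq l.2.2 5) &&
      ((Nat.beq l.1 a && Nat.beq l.2.1 b) || (Nat.beq l.1 b && Nat.beq l.2.1 a)) then some L
    else match takeGen a b L with
      | none => none
      | some L' => some (l :: L')

def walkH : List ℕ → List Link → Bool
  | [], _ => false
  | [a], L => Nat.beq a 0 && L.all fun l => Nat.beq l.2.2 5
  | a :: b :: p, L =>
    match takeGen a b L with
    | some L' => walkH (b :: p) L'
    | none => exactL L a b && walkH (b :: p) L

def ham (st : St) (p : List ℕ) : Bool :=
  nodupB p && Nat.beq p.length st.n && p.all (fun i => Nat.blt i st.n) && walkH p st.L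

def second (st : St) (x x1 : ℕ) : Bool :=
  exactL st.L x x1 && Nat.blt 0 x1 && (takeGen x x1 st.L).isNone &&
  redu ⟨st.n, st.L, x1 :: st.C⟩ [x, x1] &&
  (targets st x1).isEmpty &&
  [0, 1, 2, 3].all (fun q => killed st.n st.L x1 0 q) &&
  (targets ⟨st.n + 1, (x1, st.n, 5) :: st.L, st.C⟩ st.n).all fun s =>
    Nat.ble (degL s.L st.n) 2 && (targets s st.n).isEmpty

def splitEnd (st : St) (k i : ℕ) (l : Link) : List St :=
  let o := bif Nat.beq l.1 i then l.2.1 else l.1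
  ⟨st.n + 1, (i, st.n, 5) :: (st.n, o, (l.2.2 + 3) % 4) :: st.L.eraseIdx k, st.C⟩ ::
    (bif Nat.beq l.2.2 1 then [⟨st.n, (i, o, 5) :: st.L.eraseIdx k, st.C⟩] else [])

def runAll (g : St → List Op → Option (List Op)) : List St → List Op → Option (List Op)
  | [], h => some h
  | s :: ss, h => match g s h with
    | none => none
    | some h' => runAll g ss h'

def chkStep (rec : St → List Op → Option (List Op)) (st : St) (h : List Op) :
    Option (List Op) :=
  match h with
  | [] => none
  | .R s :: h' => bif redu st s then some h' else none
  | .X p :: h' =>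
    (match p with
      | x :: x1 :: _ => bif ham st p && second st x x1 then some h' else none
      | _ => none)
  | .S k i :: h' =>
    (match st.L[k]? with
      | none => none
      | some l =>
        bif Nat.ble 4 l.2.2 || !(Nat.beq l.1 i || Nat.beq l.2.1 i) then none
        else runAll rec (splitEnd st k i l) h')
  | .N p :: h' =>
    (match p with
      | i :: _ =>
        bif ham st p then
          runAll rec ((bif Nat.ble 3 (degL st.L i) then [⟨st.n, st.L, i :: st.C⟩] else []) ++
            targets st i) h'
        else none
      | _ => none)

def chk : ℕ → St → List Op → Option (List Op)
  | 0, _, _ => none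
  | f + 1, st, h => fN st.n fun n => fL st.L fun L => chkStep (chk f) ⟨n, L, st.C⟩ h

def start (g : ℕ) : St := ⟨3, [(0, 1, 5), (1, 2, g), (0, 2, 5)], []⟩


end C24

namespace C24

section sound

variable {V : Type} {G : SimpleGraph V}

abbrev Ent (V : Type) := Link × List V

/-- An entry is a genuine path of `G` between two marks. -/
structure EntOK (G : SimpleGraph V) (n : ℕ) (x : ℕ → V) (e : Ent V) : Prop where
  ha : e.1.1 < n
  hb : e.1.2.1 < n
  hab : e.1.1 ≠ e.1.2.1
  ch : List.IsChain G.Adj (x e.1.1 :: (e.2 ++ [x e.1.2.1]))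
  len : (e.2.length + 1) % 4 = e.1.2.2 % 4
  ex : e.1.2.2 = 5 → e.2 = []
  le : e.1.2.2 ≤ 5

def allv (n : ℕ) (x : ℕ → V) (D : List (Ent V)) : List V :=
  (List.range n).map x ++ D.flatMap Prod.snd

/-- Known neighbours of the mark `i` through one entry. -/
def Fent (x : ℕ → V) (i : ℕ) (e : Ent V) : List V :=
  (bif Nat.beq e.1.1 i then [e.2.headD (x e.1.2.1)] else []) ++
    (bif Nat.beq e.1.2.1 i then [e.2.getLastD (x e.1.1)] else [])

def Flist (x : ℕ → V) (i : ℕ) (D : List (Ent V)) : List V := D.flatMap (Fent x i)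

structure Real (G : SimpleGraph V) (st : St) (x : ℕ → V) (D : List (Ent V)) : Prop where
  map : D.map Prod.fst = st.L
  ok : ∀ e ∈ D, EntOK G st.n x e
  nd : (allv st.n x D).Nodup
  comp : ∀ i ∈ st.C, i < st.n ∧ ∀ y, G.Adj (x i) y → y ∈ Flist x i D

theorem mem_Fent {x : ℕ → V} {i : ℕ} {e : Ent V} {y : V} : y ∈ Fent x i e ↔
    (e.1.1 = i ∧ y = e.2.headD (x e.1.2.1)) ∨ (e.1.2.1 = i ∧ y = e.2.getLastD (x e.1.1)) := by
  unfold Fent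
  by_cases h1 : e.1.1 = i <;> by_cases h2 : e.1.2.1 = i <;>
    simp [h1, h2, Bool.cond_eq_ite, Nat.beq_eq]

theorem mem_Flist {x : ℕ → V} {i : ℕ} {D : List (Ent V)} {y : V} : y ∈ Flist x i D ↔
    ∃ e ∈ D, y ∈ Fent x i e := by simp [Flist]

theorem Flist_length (x : ℕ → V) (i : ℕ) (D : List (Ent V)) :
    (Flist x i D).length = degL (D.map Prod.fst) i := by
  induction D with
  | nil => rfl
  | cons e D ih =>
    have : (Fent x i e).length =
        (bif Nat.beq e.1.1 i then 1 else 0) + (bif Nat.beq e.1.2.1 i then 1 else 0) := by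
      unfold Fent; cases Nat.beq e.1.1 i <;> cases Nat.beq e.1.2.1 i <;> simp
    simp only [Flist, List.flatMap_cons, List.length_append, degL, List.map_cons, List.sum_cons] at *
    rw [this, ih]

theorem Real.inj {st : St} {x : ℕ → V} {D} (h : Real G st x D) {i j : ℕ} (hi : i < st.n)
    (hj : j < st.n) (hx : x i = x j) : i = j := by
  have := (List.nodup_append.1 h.nd).1
  exact List.inj_on_of_nodup_map this (List.mem_range.2 hi) (List.mem_range.2 hj) hx

theorem Real.mark_mem {st : St} {x : ℕ → V} {D : List (Ent V)} {i : ℕ} (hi : i < st.n) :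
    x i ∈ allv st.n x D := by
  simp only [allv, List.mem_append, List.mem_map, List.mem_range]
  exact Or.inl ⟨i, hi, rfl⟩

theorem Real.int_mem {st : St} {x : ℕ → V} {D : List (Ent V)} {e : Ent V} (he : e ∈ D) {v : V}
    (hv : v ∈ e.2) : v ∈ allv st.n x D := by
  simp only [allv, List.mem_append, List.mem_flatMap]
  exact Or.inr ⟨e, he, hv⟩

theorem Real.int_ne {st : St} {x : ℕ → V} {D} (h : Real G st x D) {e : Ent V} (he : e ∈ D) {v : V}
    (hv : v ∈ e.2) {i : ℕ} (hi : i < st.n) : v ≠ x i := by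
  have := (List.nodup_append.1 h.nd).2.2 (x i) (List.mem_map.2 ⟨i, List.mem_range.2 hi, rfl⟩) v
    (List.mem_flatMap.2 ⟨e, he, hv⟩)
  exact this.symm

theorem Real.int_nd {st : St} {x : ℕ → V} {D} (h : Real G st x D) {e : Ent V} (he : e ∈ D) :
    e.2.Nodup :=
  (List.nodup_flatMap.1 (List.nodup_append.1 h.nd).2.1).1 e he

theorem Real.int_disj {st : St} {x : ℕ → V} {D} (h : Real G st x D) {e e' : Ent V} (he : e ∈ D)
    (he' : e' ∈ D) (hne : e ≠ e') {v : V} (hv : v ∈ e.2) : v ∉ e'.2 := by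
  have := (List.nodup_flatMap.1 (List.nodup_append.1 h.nd).2.1).2
  have : Std.Symm (Function.onFun List.Disjoint (Prod.snd : Ent V → List V)) :=
    ⟨fun a b hab => List.Disjoint.symm hab⟩
  have := List.Pairwise.forall ‹List.Pairwise _ D› he he' hne
  exact fun h' => this hv h'

theorem EntOK.congr {n m : ℕ} {x x' : ℕ → V} {e : Ent V} (h : EntOK G n x e) (hnm : n ≤ m)
    (hx : ∀ j < n, x' j = x j) : EntOK G m x' e := by
  obtain ⟨h1, h2, h3, h4, h5, h6, h7⟩ := h
  exact ⟨by omega, by omega, h3, by rw [hx _ h1, hx _ h2]; exact h4, h5, h6, h7⟩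

theorem Fent_congr {n : ℕ} {x x' : ℕ → V} {e : Ent V} (h : EntOK G n x e)
    (hx : ∀ j < n, x' j = x j) (i : ℕ) : Fent x' i e = Fent x i e := by
  unfold Fent; rw [hx _ h.ha, hx _ h.hb]

theorem Flist_congr {n : ℕ} {x x' : ℕ → V} {D : List (Ent V)} (h : ∀ e ∈ D, EntOK G n x e)
    (hx : ∀ j < n, x' j = x j) (i : ℕ) : Flist x' i D = Flist x i D := by
  unfold Flist
  apply List.flatMap_congr
  exact fun e he => Fent_congr (h e he) hx i

theorem Real.perm {n : ℕ} {L : List Link} {C : List ℕ} {x : ℕ → V} {D D' : List (Ent V)}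
    (h : Real G ⟨n, L, C⟩ x D) (hp : D.Perm D') :
    Real G ⟨n, D'.map Prod.fst, C⟩ x D' where
  map := rfl
  ok := fun e he => h.ok e (hp.mem_iff.2 he)
  nd := by
    have : (allv n x D).Perm (allv n x D') := List.Perm.append_left _ (hp.flatMap_right _)
    exact this.nodup_iff.1 h.nd
  comp := fun i hi => ⟨(h.comp i hi).1, fun y hy => by
    have := (h.comp i hi).2 y hy
    rw [mem_Flist] at this ⊢
    obtain ⟨e, he, h⟩ := this
    exact ⟨e, hp.mem_iff.1 he, h⟩⟩

theorem allv_perm {n : ℕ} {x : ℕ → V} {D D' : List (Ent V)} (hp : D.Perm D') :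
    (allv n x D).Perm (allv n x D') := List.Perm.append_left _ (hp.flatMap_right _)

theorem Flist_perm {x : ℕ → V} {D D' : List (Ent V)} (hp : D.Perm D') (i : ℕ) (y : V) :
    y ∈ Flist x i D ↔ y ∈ Flist x i D' := (hp.flatMap_right _).mem_iff

/-- Reversal of an entry. -/
def flip (e : Ent V) : Ent V := ((e.1.2.1, e.1.1, e.1.2.2), e.2.reverse)

theorem isChain_rev {l : List V} (h : l.IsChain G.Adj) : l.reverse.IsChain G.Adj := by
  rw [List.isChain_reverse]
  exact h.imp (fun a b hab => hab.symm)

theorem EntOK.flip {n : ℕ} {x : ℕ → V} {e : Ent V} (h : EntOK G n x e) : EntOK G n x (flip e) := by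
  obtain ⟨h1, h2, h3, h4, h5, h6, h7⟩ := h
  refine ⟨h2, h1, h3.symm, ?_, ?_, ?_, h7⟩
  · have := isChain_rev h4
    simpa [C24.flip] using this
  · simpa [C24.flip] using h5
  · intro h; simpa [C24.flip] using h6 h

theorem Fent_flip {x : ℕ → V} {i : ℕ} {e : Ent V} {y : V} :
    y ∈ Fent x i (flip e) ↔ y ∈ Fent x i e := by
  rw [mem_Fent, mem_Fent]
  have h1 : ∀ d : V, e.2.reverse.headD d = e.2.getLastD d := by
    intro d; rw [List.getLastD_eq_getLast?, List.headD_eq_head?_getD, List.head?_reverse]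
  have h2 : ∀ d : V, e.2.reverse.getLastD d = e.2.headD d := by
    intro d; rw [List.getLastD_eq_getLast?, List.headD_eq_head?_getD, List.getLast?_reverse]
  simp only [flip, h1, h2]
  tauto

theorem Real.flipHead {n : ℕ} {L : List Link} {C : List ℕ} {x : ℕ → V} {e : Ent V}
    {D : List (Ent V)} (h : Real G ⟨n, L, C⟩ x (e :: D)) :
    Real G ⟨n, (flip e :: D).map Prod.fst, C⟩ x (flip e :: D) where
  map := rfl
  ok := by
    intro e' he'
    rcases List.mem_cons.1 he' with rfl | he'
    · exact (h.ok e (by simp)).flip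
    · exact h.ok e' (by simp [he'])
  nd := by
    have : (allv n x (e :: D)).Perm (allv n x (flip e :: D)) := by
      apply List.Perm.append_left
      simp only [List.flatMap_cons, flip]
      exact List.Perm.append_right _ (List.reverse_perm _).symm
    exact this.nodup_iff.1 h.nd
  comp := fun i hi => ⟨(h.comp i hi).1, fun y hy => by
    have := (h.comp i hi).2 y hy
    simp only [Flist, List.flatMap_cons, List.mem_append, Fent_flip] at this ⊢
    exact this⟩

theorem allv_flip {n : ℕ} {x : ℕ → V} {e : Ent V} {D : List (Ent V)} :
    (allv n x (e :: D)).Perm (allv n x (flip e :: D)) := by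
  apply List.Perm.append_left
  simp only [List.flatMap_cons, flip]
  exact List.Perm.append_right _ (List.reverse_perm _).symm

theorem allv_split {n : ℕ} {x : ℕ → V} {l l1 l2 : Link} {p q : List V} {y : V}
    {D : List (Ent V)} :
    (allv n x ((l, p ++ y :: q) :: D)).Perm
      (allv (n + 1) (Function.update x n y) ((l1, p) :: (l2, q) :: D)) := by
  unfold allv
  rw [List.range_succ, List.map_append]
  have : (List.range n).map (Function.update x n y) = (List.range n).map x := by
    apply List.map_congr_left
    intro a ha
    have : a ≠ n := by have := List.mem_range.1 ha; omega
    simp [this]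
  rw [this, List.append_assoc]
  apply List.Perm.append_left
  simp only [List.map_cons, List.map_nil, Function.update_self, List.flatMap_cons,
    List.append_assoc, List.cons_append, List.nil_append]
  exact List.perm_middle

theorem Real.split {n : ℕ} {L : List Link} {C : List ℕ} {x : ℕ → V} {a b c r r' : ℕ}
    {p q : List V} {y : V} {D : List (Ent V)}
    (h : Real G ⟨n, L, C⟩ x (((a, b, c), p ++ y :: q) :: D))
    (h1 : (p.length + 1) % 4 = r % 4) (h1' : r = 5 → p = []) (hr : r ≤ 5)
    (h2 : (q.length + 1) % 4 = r' % 4) (h2' : r' = 5 → q = []) (hr' : r' ≤ 5) :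
    Real G ⟨n + 1, (a, n, r) :: (n, b, r') :: D.map Prod.fst, C⟩ (Function.update x n y)
      (((a, n, r), p) :: ((n, b, r'), q) :: D) ∧
    ∀ j < n, ∀ z, z ∈ Flist (Function.update x n y) j (((a, n, r), p) :: ((n, b, r'), q) :: D) ↔
      z ∈ Flist x j (((a, b, c), p ++ y :: q) :: D) := by
  have hx : ∀ j < n, Function.update x n y j = x j := fun j hj => by
    rw [Function.update_of_ne]; omega
  have hF : ∀ j < n, ∀ z, z ∈ Flist (Function.update x n y) j
      (((a, n, r), p) :: ((n, b, r'), q) :: D) ↔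
      z ∈ Flist x j (((a, b, c), p ++ y :: q) :: D) := by
    intro j hj z
    have hD := Flist_congr (fun e he => h.ok e (List.mem_cons_of_mem _ he)) hx j
    unfold Flist at hD
    have hnj : n ≠ j := by omega
    have e1 : (p ++ y :: q).headD (x b) = p.headD y := by cases p <;> simp
    have e2 : (p ++ y :: q).getLastD (x a) = q.getLastD y := by
      simp [List.getLastD_eq_getLast?, List.getLast?_append, List.getLast?_cons]
    simp only [Flist, List.flatMap_cons, List.mem_append, hD, mem_Fent, e1, e2,
      Function.update_self, hnj, false_and, or_false, false_or]
    tauto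
  obtain ⟨ha, hb, hab, ch, len, ex, le⟩ := h.ok _ (List.mem_cons_self)
  simp only at ha hb hab ch len ex le
  refine ⟨⟨rfl, ?_, ?_, ?_⟩, hF⟩
  · have hc : (x a :: (p ++ [y])).IsChain G.Adj ∧ (y :: (q ++ [x b])).IsChain G.Adj := by
      have : x a :: (p ++ y :: q ++ [x b]) = (x a :: p) ++ y :: (q ++ [x b]) := by simp
      rw [this, List.isChain_split] at ch
      simpa using ch
    intro e he
    simp only [List.mem_cons] at he
    rcases he with rfl | rfl | he
    · exact ⟨by simp; omega, by simp, by simp; omega, by simpa [hx a ha] using hc.1, h1, h1', hr⟩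
    · exact ⟨by simp, by simp; omega, by simp; omega, by simpa [hx b hb] using hc.2, h2, h2', hr'⟩
    · exact (h.ok e (List.mem_cons_of_mem _ he)).congr (Nat.le_succ n) hx
  · exact allv_split.nodup_iff.1 h.nd
  · intro i hi
    obtain ⟨h1, h2⟩ := h.comp i hi
    refine ⟨Nat.lt_succ_of_lt h1, fun z hz => ?_⟩
    rw [hF i h1]
    rw [hx i h1] at hz
    exact h2 z hz

theorem Real.chord {st : St} {x : ℕ → V} {D} (h : Real G st x D) {i j : ℕ} (hi : i < st.n)
    (hj : j < st.n) (hij : G.Adj (x i) (x j)) :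
    Real G ⟨st.n, (i, j, 5) :: st.L, st.C⟩ x (((i, j, 5), []) :: D) where
  map := by simp [h.map]
  ok := by
    intro e he
    rcases List.mem_cons.1 he with rfl | he
    · refine ⟨hi, hj, ?_, by simpa using hij, by simp, by simp, by simp⟩
      rintro h; simp only at h; rw [h] at hij; exact hij.ne rfl
    · exact h.ok e he
  nd := by simpa [allv] using h.nd
  comp := fun k hk => ⟨(h.comp k hk).1, fun y hy => by
    have := (h.comp k hk).2 y hy
    simp only [Flist, List.flatMap_cons, List.mem_append] at this ⊢
    exact Or.inr this⟩

theorem Real.complete {st : St} {x : ℕ → V} {D} (h : Real G st x D) {i : ℕ} (hi : i < st.n)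
    (hc : ∀ y, G.Adj (x i) y → y ∈ Flist x i D) : Real G ⟨st.n, st.L, i :: st.C⟩ x D where
  map := h.map
  ok := h.ok
  nd := h.nd
  comp := by
    intro k hk
    rcases List.mem_cons.1 hk with rfl | hk
    · exact ⟨hi, hc⟩
    · exact h.comp k hk

theorem Real.newmark {st : St} {x : ℕ → V} {D} (h : Real G st x D) {i : ℕ} (hi : i < st.n)
    {w : V} (hw : w ∉ allv st.n x D) (hiw : G.Adj (x i) w) :
    Real G ⟨st.n + 1, (i, st.n, 5) :: st.L, st.C⟩ (Function.update x st.n w)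
      (((i, st.n, 5), []) :: D) ∧
    (allv (st.n + 1) (Function.update x st.n w) (((i, st.n, 5), []) :: D)).Perm
      (w :: allv st.n x D) := by
  have hx : ∀ j < st.n, Function.update x st.n w j = x j := fun j hj => by
    rw [Function.update_of_ne]; omega
  have hp : (allv (st.n + 1) (Function.update x st.n w) (((i, st.n, 5), []) :: D)).Perm
      (w :: allv st.n x D) := by
    unfold allv
    rw [List.range_succ, List.map_append]
    have : (List.range st.n).map (Function.update x st.n w) = (List.range st.n).map x := by
      apply List.map_congr_left
      intro a ha
      exact hx a (List.mem_range.1 ha)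
    rw [this, List.append_assoc]
    simp only [List.map_cons, List.map_nil, Function.update_self, List.flatMap_cons,
      List.cons_append, List.nil_append]
    exact List.perm_middle
  refine ⟨⟨by simp [h.map], ?_, ?_, ?_⟩, hp⟩
  · intro e he
    rcases List.mem_cons.1 he with rfl | he
    · refine ⟨by simp; omega, by simp, by simp; omega, ?_, by simp, by simp, by simp⟩
      simpa [hx i hi] using hiw
    · exact (h.ok e he).congr (Nat.le_succ _) hx
  · exact hp.nodup_iff.2 (List.nodup_cons.2 ⟨hw, h.nd⟩)
  · intro k hk
    obtain ⟨h1, h2⟩ := h.comp k hk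
    refine ⟨Nat.lt_succ_of_lt h1, fun z hz => ?_⟩
    rw [hx k h1] at hz
    have := h2 z hz
    rw [← Flist_congr h.ok hx] at this
    simp only [Flist, List.flatMap_cons, List.mem_append] at this ⊢
    exact Or.inr this

end sound

end C24

namespace C24

section sound

variable {V : Type} {G : SimpleGraph V}

/-- No cycle (as a list) of length 2 modulo 4. -/
def NoBad (G : SimpleGraph V) : Prop :=
  ∀ (a : V) (l : List V), (a :: l).Nodup → List.IsChain G.Adj (a :: (l ++ [a])) →
    2 ≤ l.length → (l.length + 1) % 4 ≠ 2

theorem part_spec (cur : ℕ) (L : List Link) :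
    ∀ (I : List (ℕ × ℕ)) (R : List Link) (k : List (ℕ × ℕ) → List Link → Bool),
    part cur L I R k = true → ∃ I' R', k I' R' = true ∧
      (∀ p ∈ I', p ∈ I ∨ (cur, p.1, p.2) ∈ L ∨ (p.1, cur, p.2) ∈ L) ∧
      (∀ l ∈ R', l ∈ R ∨ (l ∈ L ∧ l.1 ≠ cur ∧ l.2.1 ≠ cur)) := by
  induction L with
  | nil => intro I R k h; exact ⟨I, R, h, fun p hp => Or.inl hp, fun l hl => Or.inl hl⟩
  | cons l L ih =>
    obtain ⟨a, b, c⟩ := l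
    intro I R k h
    have h' : (Bool.rec (motive := fun _ => Bool)
          (Bool.rec (motive := fun _ => Bool)
            (part cur L I ((a, b, c) :: R) k)
            (part cur L ((a, c) :: I) R k)
            (Nat.beq b cur))
          (part cur L ((b, c) :: I) R k)
          (Nat.beq a cur)) = true := h
    clear h
    cases hac : Nat.beq a cur with
    | true =>
      rw [hac] at h'
      have hac : a = cur := by simpa using hac
      obtain ⟨I', R', hk, h1, h2⟩ := ih _ _ _ h'
      refine ⟨I', R', hk, fun p hp => ?_, fun l hl => ?_⟩
      · rcases h1 p hp with h | h | h
        · rcases List.mem_cons.1 h with rfl | h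
          · right; left; simp [hac]
          · exact Or.inl h
        · right; left; simp [h]
        · right; right; simp [h]
      · rcases h2 l hl with h | h
        · exact Or.inl h
        · exact Or.inr ⟨List.mem_cons_of_mem _ h.1, h.2⟩
    | false =>
      rw [hac] at h'
      have hac : a ≠ cur := by intro h; simp [h] at hac
      cases hbc : Nat.beq b cur with
      | true =>
        rw [hbc] at h'
        have hbc : b = cur := by simpa using hbc
        obtain ⟨I', R', hk, h1, h2⟩ := ih _ _ _ h'
        refine ⟨I', R', hk, fun p hp => ?_, fun l hl => ?_⟩
        · rcases h1 p hp with h | h | h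
          · rcases List.mem_cons.1 h with rfl | h
            · right; right; simp [hbc]
            · exact Or.inl h
          · right; left; simp [h]
          · right; right; simp [h]
        · rcases h2 l hl with h | h
          · exact Or.inl h
          · exact Or.inr ⟨List.mem_cons_of_mem _ h.1, h.2⟩
      | false =>
        rw [hbc] at h'
        have hbc : b ≠ cur := by intro h; simp [h] at hbc
        obtain ⟨I', R', hk, h1, h2⟩ := ih _ _ _ h'
        refine ⟨I', R', hk, fun p hp => ?_, fun l hl => ?_⟩
        · rcases h1 p hp with h | h | h
          · exact Or.inl h
          · right; left; simp [h]
          · right; right; simp [h]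
        · rcases h2 l hl with h | h
          · rcases List.mem_cons.1 h with rfl | h
            · exact Or.inr ⟨by simp, hac, hbc⟩
            · exact Or.inl h
          · exact Or.inr ⟨List.mem_cons_of_mem _ h.1, h.2⟩

theorem fN_eq {α : Type} (n : ℕ) (k : ℕ → α) : fN n k = k n := by
  cases n <;> rfl

theorem fL_eq {α : Type} (L : List Link) : ∀ (k : List Link → α), fL L k = k L := by
  induction L with
  | nil => intro k; rfl
  | cons l L ih =>
    intro k
    have : fL (l :: L) k = fL L fun L' => fN l.1 fun a => fN l.2.1 fun b => fN l.2.2 fun c =>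
      k ((a, b, c) :: L') := rfl
    rw [this, ih]
    simp [fN_eq]

theorem dfs_succ {tgt f : ℕ} {L : List Link} {cur need : ℕ} (h : dfs tgt (f + 1) L cur need = true) :
    (cur = tgt ∧ need = 0) ∨ (cur ≠ tgt ∧ ∃ R z c, (∀ l ∈ R, l ∈ L ∧ l.1 ≠ cur ∧ l.2.1 ≠ cur) ∧
      ((cur, z, c) ∈ L ∨ (z, cur, c) ∈ L) ∧ dfs tgt f R z ((need + 8 - c) % 4) = true) := by
  have h' : (Bool.rec (motive := fun _ => Bool)
      (part cur L [] [] fun I R =>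
        List.rec (motive := fun _ => Bool) false
         (fun p _ ih2 => Bool.rec (motive := fun _ => Bool) ih2 true
            (Prod.rec (motive := fun _ => Bool) (fun z c =>
              fN (Nat.mod (Nat.sub (Nat.add need 8) c) 4) fun m => dfs tgt f R z m) p)) I)
      (Nat.beq need 0)
      (Nat.beq cur tgt)) = true := h
  cases hc : Nat.beq cur tgt with
  | true =>
    rw [hc] at h'
    left
    exact ⟨by simpa using hc, by simpa using h'⟩
  | false =>
    rw [hc] at h'
    right
    refine ⟨by intro h; simp [h] at hc, ?_⟩
    obtain ⟨I, R, hk, h1, h2⟩ := part_spec _ _ _ _ _ h'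
    have : ∃ p ∈ I, dfs tgt f R p.1 ((need + 8 - p.2) % 4) = true := by
      clear h1 h' h
      induction I with
      | nil => exact absurd hk (by simp)
      | cons p I ih =>
        obtain ⟨z, c⟩ := p
        cases hz : dfs tgt f R z ((need + 8 - c) % 4) with
        | true => exact ⟨(z, c), by simp, hz⟩
        | false =>
          have hk' : (Bool.rec (motive := fun _ => Bool)
            (List.rec (motive := fun _ => Bool) false
             (fun p _ ih2 => Bool.rec (motive := fun _ => Bool) ih2 true
              (Prod.rec (motive := fun _ => Bool) (fun z c =>
                fN (Nat.mod (Nat.sub (Nat.add need 8) c) 4) fun m => dfs tgt f R z m) p)) I)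
            true (fN ((need + 8 - c) % 4) fun m => dfs tgt f R z m)) = true := hk
          rw [fN_eq, hz] at hk'
          obtain ⟨p, hp, h⟩ := ih hk'
          exact ⟨p, List.mem_cons_of_mem _ hp, h⟩
    obtain ⟨p, hp, hd⟩ := this
    refine ⟨R, p.1, p.2, fun l hl => ?_, ?_, hd⟩
    · rcases h2 l hl with h | h
      · simp at h
      · exact h
    · rcases h1 p hp with h | h
      · simp at h
      · exact h

theorem getLast_aux {a b : V} {p q : List V} {v : V} (h : (b :: q).getLast? = some v) :
    (a :: (p ++ b :: q)).getLast? = some v := by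
  have : a :: (p ++ b :: q) = (a :: p) ++ b :: q := by simp
  rw [this, List.getLast?_append, h]; rfl

theorem dfs_sound {st : St} {x : ℕ → V} {D} (h : Real G st x D) (tgt : ℕ) (f : ℕ) :
    ∀ (L : List Link) (cur need : ℕ), cur < st.n → need < 4 → (∀ l ∈ L, ∃ e ∈ D, e.1 = l) →
    dfs tgt f L cur need = true →
    ∃ q : List V, (x cur :: q).IsChain G.Adj ∧ (x cur :: q).Nodup ∧
      (x cur :: q).getLast? = some (x tgt) ∧ q.length % 4 = need ∧
      (∀ v ∈ q, (∃ l ∈ L, v = x l.1 ∨ v = x l.2.1) ∨ ∃ e ∈ D, e.1 ∈ L ∧ v ∈ e.2) ∧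
      (cur ≠ tgt → ∃ v q', q = v :: q' ∧ v ∈ Flist x cur D) := by
  induction f with
  | zero => intro L cur need _ _ _ h; exact absurd h (by simp [dfs])
  | succ f ih =>
    intro L cur need hcur hneed hL hd
    rcases dfs_succ hd with ⟨rfl, rfl⟩ | ⟨hne, R, z, c, hR, hz, hd⟩
    · exact ⟨[], by simp, by simp, by simp, by simp, by simp, by simp⟩
    have main : ∃ l ∈ L, ∃ e ∈ D, e.1 = l ∧ c = l.2.2 ∧ z < st.n ∧ z ≠ cur ∧ 
        (l.1 = cur ∨ l.2.1 = cur) ∧ (z = l.1 ∨ z = l.2.1) ∧ ∃ p : List V, 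
        (∀ v, v ∈ p ↔ v ∈ e.2) ∧ p.Nodup ∧ (x cur :: (p ++ [x z])).IsChain G.Adj ∧
        (p.length + 1) % 4 = c % 4 ∧ c ≤ 5 ∧ p.headD (x z) ∈ Flist x cur D := by
      rcases hz with hz | hz
      · obtain ⟨e, he, hel⟩ := hL _ hz
        obtain ⟨h1, h2, h3, h4, h5, h6, h7⟩ := h.ok e he
        have hFl : e.2.headD (x e.1.2.1) ∈ Flist x e.1.1 D :=
          mem_Flist.2 ⟨e, he, mem_Fent.2 (Or.inl ⟨rfl, rfl⟩)⟩
        have hnd := h.int_nd he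
        rw [hel] at h1 h2 h3 h4 h5 h6 h7 hFl
        exact ⟨_, hz, e, he, hel, rfl, h2, h3.symm, by simp, by simp, e.2, fun v => Iff.rfl,
          hnd, h4, h5, h7, hFl⟩
      · obtain ⟨e, he, hel⟩ := hL _ hz
        obtain ⟨h1, h2, h3, h4, h5, h6, h7⟩ := (h.ok e he).flip
        have hFl : (flip e).2.headD (x (flip e).1.2.1) ∈ Flist x (flip e).1.1 D :=
          mem_Flist.2 ⟨e, he, Fent_flip.1 (mem_Fent.2 (Or.inl ⟨rfl, rfl⟩))⟩
        have hnd := h.int_nd he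
        simp only [flip, hel] at h1 h2 h3 h4 h5 h6 h7 hFl
        exact ⟨_, hz, e, he, hel, rfl, h2, h3.symm, by simp, by simp, e.2.reverse,
          fun v => by simp, by simpa using hnd, h4, h5, h7, hFl⟩
    obtain ⟨l, hl, e, he, hel, hc, hzn, hzc, hlc, hlz, p, hpe, hpn, hpc, hpl, hc5, hpF⟩ := main
    obtain ⟨q, q1, q2, q3, q4, q5, -⟩ := ih R z _ hzn (Nat.mod_lt _ (by norm_num))
      (fun l hl => hL l (hR l hl).1) hd
    have hmark : ∀ l ∈ L, l.1 < st.n ∧ l.2.1 < st.n := by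
      intro l hl
      obtain ⟨e, he, hel⟩ := hL _ hl
      have := h.ok e he
      exact hel ▸ ⟨this.ha, this.hb⟩
    have hqcur : x cur ∉ q := by
      intro hq
      rcases q5 _ hq with ⟨l, hl, h' | h'⟩ | ⟨e, he, hl, h'⟩
      · exact (hR l hl).2.1 (h.inj hcur (hmark l (hR l hl).1).1 h').symm
      · exact (hR l hl).2.2 (h.inj hcur (hmark l (hR l hl).1).2 h').symm
      · exact h.int_ne he h' hcur rfl
    have hqp : ∀ v ∈ p, v ∉ q := by
      intro v hv hq
      have hv := (hpe v).1 hv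
      rcases q5 _ hq with ⟨l, hl, h' | h'⟩ | ⟨e', he', hl, h'⟩
      · exact h.int_ne he hv (hmark l (hR l hl).1).1 h'
      · exact h.int_ne he hv (hmark l (hR l hl).1).2 h'
      · refine h.int_disj he he' ?_ hv h'
        rintro rfl
        rw [hel] at hl
        rcases hlc with h | h
        · exact (hR l hl).2.1 h
        · exact (hR l hl).2.2 h
    refine ⟨p ++ x z :: q, ?_, ?_, ?_, ?_, ?_, ?_⟩
    · have : x cur :: (p ++ x z :: q) = (x cur :: p) ++ x z :: q := by simp
      rw [this, List.isChain_split]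
      exact ⟨by simpa using hpc, q1⟩
    · have hzp : x z ∉ p := fun hv => h.int_ne he ((hpe _).1 hv) hzn rfl
      have hcp : x cur ∉ p := fun hv => h.int_ne he ((hpe _).1 hv) hcur rfl
      have hcz : x cur ≠ x z := fun hv => hzc (h.inj hcur hzn hv).symm
      rw [List.nodup_cons]
      refine ⟨by simp [hcp, hcz, hqcur], ?_⟩
      rw [List.nodup_append]
      refine ⟨hpn, q2, ?_⟩
      rintro a ha b hb rfl
      rcases List.mem_cons.1 hb with rfl | hb
      · exact hzp ha
      · exact hqp a ha hb
    · exact getLast_aux q3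
    · simp only [List.length_append, List.length_cons]
      omega
    · intro v hv
      rcases List.mem_append.1 hv with hv | hv
      · exact Or.inr ⟨e, he, hel ▸ hl, (hpe v).1 hv⟩
      · rcases List.mem_cons.1 hv with rfl | hv
        · left
          refine ⟨l, hl, ?_⟩
          rcases hlz with h | h <;> simp [← h]
        · rcases q5 v hv with ⟨l, hl, h'⟩ | ⟨e, he, hl, h'⟩
          · exact Or.inl ⟨l, (hR l hl).1, h'⟩
          · exact Or.inr ⟨e, he, (hR _ hl).1, h'⟩
    · intro _
      cases p with
      | nil => exact ⟨x z, q, by simp, by simpa using hpF⟩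
      | cons v p => exact ⟨v, p ++ x z :: q, by simp, by simpa using hpF⟩

theorem kill {st : St} {x : ℕ → V} {D} (h : Real G st x D) (hN : NoBad G) {a b r : ℕ}
    (ha : a < st.n) (hb : b < st.n) (hab : a ≠ b) (hr : r < 4)
    (hk : killed st.n st.L a b r = true) (s : List V) (hs : s.Nodup)
    (hsd : ∀ v ∈ s, v ∉ allv st.n x D) (hc : (x b :: (s ++ [x a])).IsChain G.Adj)
    (hl : (s.length + 1) % 4 = r) (h0 : s = [] → x b ∉ Flist x a D) : False := by
  have hL : ∀ l ∈ st.L, ∃ e ∈ D, e.1 = l := by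
    intro l hl
    rw [← h.map] at hl
    simpa using hl
  obtain ⟨q, q1, q2, q3, q4, q5, q6⟩ := dfs_sound h b _ st.L a ((6 - r) % 4) ha
    (Nat.mod_lt _ (by norm_num)) hL hk
  obtain ⟨v, q', rfl, hv⟩ := q6 hab
  have hmem : ∀ w ∈ (x a :: v :: q'), w ∈ allv st.n x D := by
    intro w hw
    rcases List.mem_cons.1 hw with rfl | hw
    · exact Real.mark_mem ha
    rcases q5 w hw with ⟨l, hl, h'⟩ | ⟨e, he, hl, h'⟩
    · obtain ⟨e, he, hel⟩ := hL _ hl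
      have := h.ok e he
      rw [← hel] at h'
      rcases h' with rfl | rfl
      · exact Real.mark_mem this.ha
      · exact Real.mark_mem this.hb
    · exact Real.int_mem he h'
  have hlast : (v :: q').getLast? = some (x b) := by
    rwa [List.getLast?_cons_cons] at q3
  refine hN (x a) ((v :: q') ++ s) ?_ ?_ ?_ ?_
  · rw [← List.cons_append, List.nodup_append]
    refine ⟨q2, hs, ?_⟩
    rintro w hw w' hw' rfl
    exact hsd w hw' (hmem w hw)
  · obtain ⟨q0, hq0⟩ : ∃ q0, v :: q' = q0 ++ [x b] := by
      obtain ⟨q0, hq0⟩ := List.getLast?_eq_some_iff.1 hlast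
      exact ⟨q0, hq0⟩
    rw [hq0] at q1 ⊢
    have : x a :: (q0 ++ [x b] ++ s ++ [x a]) = (x a :: q0) ++ x b :: (s ++ [x a]) := by simp
    rw [this, List.isChain_split]
    exact ⟨by simpa using q1, hc⟩
  · cases s with
    | cons w s => simp; omega
    | nil =>
      cases q' with
      | cons w q' => simp
      | nil =>
        simp only [List.getLast?_singleton, Option.some.injEq] at hlast
        exact absurd (hlast ▸ hv) (h0 rfl)
  · simp only [List.length_append]
    omega

end sound

end C24

namespace C24

section sound

variable {V : Type} {G : SimpleGraph V}

theorem memb_iff (a : ℕ) (l : List ℕ) : memb a l = true ↔ a ∈ l := by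
  induction l with
  | nil => simp [memb]
  | cons b l ih =>
    have : memb a (b :: l) = Bool.rec (motive := fun _ => Bool) (memb a l) true (Nat.beq a b) := rfl
    rw [this]
    cases h : Nat.beq a b with
    | true => have h : a = b := by simpa using h
              simp [h]
    | false => have h : a ≠ b := by rintro rfl; simp at h
               simp [h, ih]

theorem exactL_iff (L : List Link) (i j : ℕ) :
    exactL L i j = true ↔ (i, j, 5) ∈ L ∨ (j, i, 5) ∈ L := by
  simp only [exactL, List.any_eq_true, Bool.and_eq_true, Bool.or_eq_true, Nat.beq_eq]
  constructor
  · rintro ⟨⟨a, b, c⟩, hl, rfl, ⟨rfl, rfl⟩ | ⟨rfl, rfl⟩⟩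
    · exact Or.inl hl
    · exact Or.inr hl
  · rintro (h | h)
    · exact ⟨_, h, rfl, Or.inl ⟨rfl, rfl⟩⟩
    · exact ⟨_, h, rfl, Or.inr ⟨rfl, rfl⟩⟩

theorem Real.exact_mem {st : St} {x : ℕ → V} {D} (h : Real G st x D) {i j : ℕ}
    (he : exactL st.L i j = true) : x j ∈ Flist x i D := by
  rw [exactL_iff, ← h.map] at he
  simp only [List.mem_map] at he
  rcases he with ⟨e, he, h'⟩ | ⟨e, he, h'⟩
  · have := (h.ok e he).ex (by rw [h'])
    exact mem_Flist.2 ⟨e, he, mem_Fent.2 (Or.inl (by simp [h', this]))⟩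
  · have := (h.ok e he).ex (by rw [h'])
    exact mem_Flist.2 ⟨e, he, mem_Fent.2 (Or.inr (by simp [h', this]))⟩

theorem exact_adj {n : ℕ} {L : List Link} {x : ℕ → V} {D : List (Ent V)}
    (hm : D.map Prod.fst = L) (hok : ∀ e ∈ D, EntOK G n x e) {i j : ℕ}
    (he : exactL L i j = true) : G.Adj (x i) (x j) := by
  rw [exactL_iff, ← hm] at he
  simp only [List.mem_map] at he
  rcases he with ⟨e, he, h'⟩ | ⟨e, he, h'⟩
  · have h1 := (hok e he).ex (by rw [h'])
    have h2 := (hok e he).ch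
    simpa [h1, h'] using h2
  · have h1 := (hok e he).ex (by rw [h'])
    have h2 := (hok e he).ch
    have h3 : G.Adj (x j) (x i) := by simpa [h1, h'] using h2
    exact h3.symm

theorem Real.F_symm {st : St} {x : ℕ → V} {D} (h : Real G st x D) {i j : ℕ} (hi : i < st.n)
    (he : x i ∈ Flist x j D) : x j ∈ Flist x i D := by
  obtain ⟨e, he, hm⟩ := mem_Flist.1 he
  refine mem_Flist.2 ⟨e, he, ?_⟩
  have hok := h.ok e he
  have h_int : ∀ v ∈ e.2, v ≠ x i := fun v hv => h.int_ne he hv hi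
  rw [mem_Fent] at hm ⊢
  rcases hm with ⟨h1, h2⟩ | ⟨h1, h2⟩
  · right
    cases hp : e.2 with
    | cons v p => rw [hp] at h2 h_int; exact absurd h2.symm (h_int v (by simp))
    | nil =>
      rw [hp] at h2
      exact ⟨(h.inj hi hok.hb h2).symm, by simp [h1]⟩
  · left
    rcases List.eq_nil_or_concat e.2 with hp | ⟨p, v, hp⟩
    · rw [hp] at h2
      exact ⟨(h.inj hi hok.ha h2).symm, by simp [h1, hp]⟩
    · rw [hp] at h2 h_int
      have : x i = v := by simpa [List.getLastD_eq_getLast?] using h2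
      exact absurd this.symm (h_int v (by simp))

theorem targets_sound {st : St} {x : ℕ → V} {D} (h : Real G st x D) (hN : NoBad G) {i : ℕ}
    (hi : i < st.n) {y : V} (hy : G.Adj (x i) y) (hyF : y ∉ Flist x i D)
    (hyA : y ∈ allv st.n x D) :
    ∃ st' ∈ targets st i, ∃ x' D', Real G st' x' D' ∧ (∀ j < st.n, x' j = x j) ∧
      st.n ≤ st'.n ∧ ∀ v, v ∈ allv st'.n x' D' ↔ v ∈ allv st.n x D := by
  rcases List.mem_append.1 hyA with hm | hm
  · obtain ⟨j, hj, rfl⟩ := List.mem_map.1 hm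
    rw [List.mem_range] at hj
    have hij : i ≠ j := by rintro rfl; exact hy.ne rfl
    have b1 : Nat.beq j i = false := by
      rw [Bool.eq_false_iff]; intro h; exact hij (Nat.eq_of_beq_eq_true h).symm
    have b2 : memb j st.C = false := by
      rw [Bool.eq_false_iff, ne_eq, memb_iff]
      intro hj'
      exact hyF (h.F_symm hi ((h.comp j hj').2 _ hy.symm))
    have b3 : exactL st.L i j = false := by
      rw [Bool.eq_false_iff]; intro he; exact hyF (h.exact_mem he)
    have b4 : killed st.n st.L i j 1 = false := by
      rw [Bool.eq_false_iff]; intro hk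
      exact kill h hN hi hj hij (by norm_num) hk [] (by simp) (by simp) (by simpa using hy.symm)
        (by simp) (fun _ => hyF)
    refine ⟨_, ?_, x, _, h.chord hi hj hy, fun _ _ => rfl, le_refl _, fun v => by simp [allv]⟩
    apply List.mem_append_left
    rw [List.mem_flatMap]
    exact ⟨j, List.mem_range.2 hj, by simp [b1, b2, b3, b4]⟩
  · obtain ⟨e, he, hye⟩ := List.mem_flatMap.1 hm
    obtain ⟨k, hk, hke⟩ := List.mem_iff_getElem.1 he
    obtain ⟨⟨a, b, c⟩, p0⟩ := e
    obtain ⟨p, q, rfl⟩ := List.append_of_mem hye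
    have hperm : D.Perm (((a, b, c), p ++ y :: q) :: D.eraseIdx k) := by
      rw [← hke]
      exact (List.getElem_cons_eraseIdx_perm hk).symm
    have h2 := Real.perm (n := st.n) (L := st.L) (C := st.C) h hperm
    obtain ⟨ha, hb, hab, ch, len, ex, le⟩ := h.ok _ he
    simp only at ha hb hab ch len ex le
    have hc5 : c ≠ 5 := fun h => by simpa using ex h
    have hlen : (p ++ y :: q).length = p.length + q.length + 1 := by simp; omega
    rw [hlen] at len
    obtain ⟨h3, hF⟩ := h2.split (r := (p.length + 1) % 4)
      (r' := (c + 4 - (p.length + 1) % 4) % 4) (by omega) (by omega) (by omega) (by omega) (by omega)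
      (by omega)
    have hx : ∀ j < st.n, Function.update x st.n y j = x j := fun j hj => by
      rw [Function.update_of_ne]; omega
    have hyF' : y ∉ Flist x i (((a, b, c), p ++ y :: q) :: D.eraseIdx k) := by
      rwa [← Flist_perm hperm]
    have hLk : st.L.eraseIdx k = (D.eraseIdx k).map Prod.fst := by
      rw [← h.map, List.eraseIdx_map]
    have hLk2 : st.L[k]? = some (a, b, c) := by
      rw [← h.map]; simp [hk, hke]
    have hkl : killed (st.n + 1) (splitL st.n st.L k (a, b, c) ((p.length + 1) % 4)) i st.n 1
        = false := by
      rw [Bool.eq_false_iff]; intro hk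
      simp only [splitL, hLk] at hk
      refine kill h3 hN (a := i) (b := st.n) (by simp only; omega) (by simp) (by omega)
        (by norm_num) hk [] (by simp) (by simp) ?_ (by simp) ?_
      · simpa [hx i hi] using hy.symm
      · intro _
        rw [hF i hi]
        simpa using hyF'
    refine ⟨_, ?_, _, _, h3.chord (i := i) (j := st.n) (by simp only; omega) (by simp) ?_,
      hx, by simp, ?_⟩
    · apply List.mem_append_right
      rw [List.mem_flatMap]
      refine ⟨k, List.mem_range.2 (by rw [← h.map]; simpa using hk), ?_⟩
      rw [hLk2]
      have : Nat.beq c 5 = false := by rw [Bool.eq_false_iff, ne_eq, Nat.beq_eq]; exact hc5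
      simp only [this, cond_false]
      rw [List.mem_flatMap]
      refine ⟨(p.length + 1) % 4, ?_, ?_⟩
      · have : (p.length + 1) % 4 < 4 := Nat.mod_lt _ (by norm_num)
        generalize (p.length + 1) % 4 = t at *
        interval_cases t <;> simp
      · simp only [fL_eq, hkl, cond_false, List.mem_singleton]
        simp [splitL, hLk]
    · simpa [hx i hi] using hy
    · intro v
      rw [(allv_perm hperm).mem_iff, (allv_split (l1 := (a, st.n, (p.length + 1) % 4))
        (l2 := (st.n, b, (c + 4 - (p.length + 1) % 4) % 4))).mem_iff]
      simp [allv]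

end sound

end C24

namespace C24

section sound

variable {V : Type} {G : SimpleGraph V}

theorem takeGen_sound {a b : ℕ} {L : List Link} : ∀ {L' : List Link} {D : List (Ent V)},
    takeGen a b L = some L' → D.map Prod.fst = L →
    ∃ e D', D.Perm (e :: D') ∧ D'.map Prod.fst = L' ∧
      ((e.1.1 = a ∧ e.1.2.1 = b) ∨ (e.1.1 = b ∧ e.1.2.1 = a)) := by
  induction L with
  | nil => intro L' D h; simp [takeGen] at h
  | cons l L ih =>
    intro L' D h hD
    obtain ⟨e, D, rfl, hel, hD⟩ := List.map_eq_cons_iff.1 hD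
    rw [takeGen] at h
    cases hb : (!(Nat.beq l.2.2 5) &&
      ((Nat.beq l.1 a && Nat.beq l.2.1 b) || (Nat.beq l.1 b && Nat.beq l.2.1 a))) with
    | true =>
      rw [hb] at h
      simp only [cond_true, Option.some.injEq] at h
      subst h
      refine ⟨e, D, List.Perm.refl _, hD, ?_⟩
      rw [hel]
      simp only [Bool.and_eq_true, Bool.or_eq_true, Nat.beq_eq] at hb
      exact hb.2
    | false =>
      rw [hb] at h
      simp only [cond_false] at h
      cases ht : takeGen a b L with
      | none => rw [ht] at h; simp at h
      | some L1 =>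
        rw [ht] at h
        simp only [Option.some.injEq] at h
        subst h
        obtain ⟨e', D', h1, h2, h3⟩ := ih ht hD
        exact ⟨e', e :: D', ((h1.cons e).trans (List.Perm.swap _ _ _)), by simp [h2, hel], h3⟩

theorem walkH_sound {n : ℕ} {x : ℕ → V} (p : List ℕ) : ∀ (a : ℕ) (L : List Link) (D : List (Ent V)),
    walkH (a :: p) L = true → D.map Prod.fst = L → (∀ e ∈ D, EntOK G n x e) →
    ∃ h, (x a :: h).IsChain G.Adj ∧ (x a :: h).getLast? = some (x 0) ∧
      (x a :: h).Perm ((a :: p).map x ++ D.flatMap Prod.snd) ∧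
      (∀ b p', p = b :: p' → takeGen a b L = none → ∃ h', h = x b :: h') := by
  induction p with
  | nil =>
    intro a L D hw hD hok
    simp only [walkH, Bool.and_eq_true, Nat.beq_eq, List.all_eq_true] at hw
    obtain ⟨rfl, hL⟩ := hw
    refine ⟨[], by simp, by simp, ?_, by simp⟩
    have : D.flatMap Prod.snd = [] := by
      rw [List.flatMap_eq_nil_iff]
      intro e he
      refine (hok e he).ex (hL e.1 ?_)
      rw [← hD]
      exact List.mem_map_of_mem he
    simp [this]
  | cons b p ih =>
    intro a L D hw hD hok
    rw [walkH] at hw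
    cases ht : takeGen a b L with
    | none =>
      rw [ht] at hw
      simp only [Bool.and_eq_true] at hw
      obtain ⟨h, h1, h2, h3, -⟩ := ih b L D hw.2 hD hok
      refine ⟨x b :: h, ?_, ?_, ?_, ?_⟩
      · exact List.IsChain.cons_cons (exact_adj hD hok hw.1) h1
      · rw [List.getLast?_cons_cons]; exact h2
      · rw [List.map_cons, List.cons_append]; exact h3.cons _
      · intro b' p' hbp _
        obtain ⟨rfl, rfl⟩ := List.cons.inj hbp
        exact ⟨h, rfl⟩
    | some L' =>
      rw [ht] at hw
      obtain ⟨e, D', hp, hD', he⟩ := takeGen_sound ht hD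
      have heok := hok e (hp.mem_iff.2 (by simp))
      obtain ⟨h, h1, h2, h3, -⟩ := ih b L' D' hw hD'
        (fun e he => hok e (hp.mem_iff.2 (by simp [he])))
      have : ∃ q : List V, q.Perm e.2 ∧ (x a :: (q ++ [x b])).IsChain G.Adj := by
        rcases he with ⟨rfl, rfl⟩ | ⟨rfl, rfl⟩
        · exact ⟨e.2, List.Perm.refl _, heok.ch⟩
        · exact ⟨e.2.reverse, List.reverse_perm _, heok.flip.ch⟩
      obtain ⟨q, hq, hqc⟩ := this
      refine ⟨q ++ x b :: h, ?_, getLast_aux h2, ?_, ?_⟩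
      · have : x a :: (q ++ x b :: h) = (x a :: q) ++ x b :: h := by simp
        rw [this, List.isChain_split]
        exact ⟨by simpa using hqc, h1⟩
      · have e1 : (D.flatMap Prod.snd).Perm (q ++ D'.flatMap Prod.snd) := by
          refine (hp.flatMap_right _).trans ?_
          rw [List.flatMap_cons]
          exact List.Perm.append_right _ hq.symm
        refine List.Perm.trans ?_ (List.Perm.append_left _ e1.symm)
        rw [List.map_cons, List.cons_append]
        refine List.Perm.cons _ ?_
        refine (List.Perm.append_left q h3).trans ?_
        rw [← List.append_assoc, ← List.append_assoc]
        exact List.Perm.append_right _ List.perm_append_comm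
      · intro b' p' hbp hn
        obtain ⟨rfl, rfl⟩ := List.cons.inj hbp
        simp [ht] at hn

theorem nodupB_iff (l : List ℕ) : nodupB l = true ↔ l.Nodup := by
  induction l with
  | nil => simp [nodupB]
  | cons a l ih =>
    simp only [nodupB, Bool.and_eq_true, ih, List.nodup_cons, Bool.not_eq_true']
    rw [Bool.eq_false_iff, ne_eq, memb_iff]

theorem ham_sound {st : St} {x : ℕ → V} {D} (h : Real G st x D) {a : ℕ} {p : List ℕ}
    (hh : ham st (a :: p) = true) : a < st.n ∧ ∃ h, (x a :: h).IsChain G.Adj ∧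
      (x a :: h).getLast? = some (x 0) ∧ (x a :: h).Perm (allv st.n x D) ∧
      (∀ b p', p = b :: p' → takeGen a b st.L = none → b < st.n ∧ ∃ h', h = x b :: h') := by
  simp only [ham, Bool.and_eq_true, nodupB_iff, Nat.beq_eq, List.all_eq_true] at hh
  obtain ⟨⟨⟨h1, h2⟩, h3⟩, h4⟩ := hh
  have h3 : ∀ i ∈ a :: p, i < st.n := fun i hi => by simpa [Nat.blt] using h3 i hi
  have hperm : (a :: p).Perm (List.range st.n) := by
    have hs : (a :: p).Subperm (List.range st.n) :=
      List.subperm_of_subset h1 (fun i hi => List.mem_range.2 (h3 i hi))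
    exact hs.perm_of_length_le (by simp [← h2])
  obtain ⟨q, q1, q2, q3, q4⟩ := walkH_sound p a st.L D h4 h.map h.ok
  refine ⟨h3 a (by simp), q, q1, q2, q3.trans (List.Perm.append_right _ (hperm.map x)), ?_⟩
  intro b p' hb hn
  exact ⟨h3 b (by simp [hb]), q4 b p' hb hn⟩

structure Ctx (G : SimpleGraph V) (Cs : List V) (T : V) : Prop where
  nobad : NoBad G
  mindeg : ∀ (v : V) (F : List V), F.length ≤ 2 → ∃ y, G.Adj v y ∧ y ∉ F
  endn : ∀ (v : V) (h : List V), (v :: h).IsChain G.Adj → (v :: h).Perm Cs →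
    (v :: h).getLast? = some T → ∀ y, G.Adj v y → y ∈ Cs
  second : ∀ (v v1 : V) (h : List V), (v :: v1 :: h).IsChain G.Adj → (v :: v1 :: h).Perm Cs →
    (v :: v1 :: h).getLast? = some T → ∀ y, G.Adj v1 y → y ∈ Cs ∨
      (∃ s : List V, s ≠ [] ∧ s.Nodup ∧ (∀ w ∈ s, w ∉ Cs) ∧ (T :: (s ++ [v1])).IsChain G.Adj) ∨
      (y ∉ Cs ∧ ∀ z, G.Adj y z → z ∈ Cs)
  red : ∀ S : List V, S ≠ [] → S.Nodup → T ∉ S → ∀ Es : List (Sym2 V),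
    (∀ v ∈ S, ∀ y, G.Adj v y → s(v, y) ∈ Es) → 5 * S.length < 2 * Es.length

/-- The edges charged to an entry by the marks in `s`. -/
def Eent (x : ℕ → V) (s : List ℕ) (e : Ent V) : List (Sym2 V) :=
  bif Nat.beq e.1.2.2 5 then (bif memb e.1.1 s || memb e.1.2.1 s then [s(x e.1.1, x e.1.2.1)] else [])
  else (bif memb e.1.1 s then [s(x e.1.1, e.2.headD (x e.1.2.1))] else []) ++
    (bif memb e.1.2.1 s then [s(x e.1.2.1, e.2.getLastD (x e.1.1))] else [])

theorem Eent_length (x : ℕ → V) (s : List ℕ) (D : List (Ent V)) :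
    (D.flatMap (Eent x s)).length = costL (D.map Prod.fst) s := by
  induction D with
  | nil => rfl
  | cons e D ih =>
    have : (Eent x s e).length =
      bif Nat.beq e.1.2.2 5 then (bif memb e.1.1 s || memb e.1.2.1 s then 1 else 0)
      else (bif memb e.1.1 s then 1 else 0) + (bif memb e.1.2.1 s then 1 else 0) := by
      unfold Eent
      cases Nat.beq e.1.2.2 5 <;> cases memb e.1.1 s <;> cases memb e.1.2.1 s <;> simp
    simp only [List.flatMap_cons, List.length_append, costL, List.map_cons, List.sum_cons] at *
    rw [this, ih]

theorem redu_sound {Cs : List V} {T : V} (hc : Ctx G Cs T) {st : St} {x : ℕ → V} {D}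
    (h : Real G st x D) (h0 : x 0 = T) (hn : 0 < st.n) {s : List ℕ} (hr : redu st s = true) :
    False := by
  simp only [redu, Bool.and_eq_true, nodupB_iff, List.all_eq_true, memb_iff] at hr
  obtain ⟨⟨⟨h1, h2⟩, h3⟩, h4⟩ := hr
  have h2 : 0 < s.length := Nat.le_of_ble_eq_true h2
  have h3' : ∀ i ∈ s, 0 < i := fun i hi => Nat.le_of_ble_eq_true (h3 i hi).2
  have h4 : 2 * costL st.L s ≤ 5 * s.length := Nat.le_of_ble_eq_true h4
  have hlt : ∀ i ∈ s, i < st.n := fun i hi => (h.comp i (h3 i hi).1).1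
  have := hc.red (s.map x) (by intro h; simp at h; simp [h] at h2) ?_ ?_ (D.flatMap (Eent x s)) ?_
  · rw [Eent_length, h.map, List.length_map] at this
    omega
  · refine List.Nodup.map_on ?_ h1
    intro i hi j hj hij
    exact h.inj (hlt i hi) (hlt j hj) hij
  · intro hT
    obtain ⟨i, hi, hiT⟩ := List.mem_map.1 hT
    have := h.inj (hlt i hi) hn (hiT.trans h0.symm)
    have := h3' i hi
    omega
  · intro v hv y hy
    obtain ⟨i, hi, rfl⟩ := List.mem_map.1 hv
    obtain ⟨e, he, hye⟩ := mem_Flist.1 ((h.comp i (h3 i hi).1).2 y hy)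
    refine List.mem_flatMap.2 ⟨e, he, ?_⟩
    have hms := (memb_iff i s).2 hi
    rw [mem_Fent] at hye
    unfold Eent
    cases h5 : Nat.beq e.1.2.2 5 with
    | true =>
      have hp := (h.ok e he).ex (by simpa using h5)
      rw [hp] at hye
      rcases hye with ⟨h6, h7⟩ | ⟨h6, h7⟩
      · simp only [List.headD_nil] at h7
        simp [h6, h7, hms]
      · simp only [List.getLastD_nil] at h7
        simp [h6, h7, hms, Sym2.eq_swap]
    | false =>
      rcases hye with ⟨h6, h7⟩ | ⟨h6, h7⟩
      · rw [h6, h7]; simp [hms]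
      · rw [h6, h7]; simp [hms]

theorem second_sound {Cs : List V} {T : V} (hc : Ctx G Cs T) {st : St} {x : ℕ → V} {D}
    (h : Real G st x D) (h0 : x 0 = T) (hn : 0 < st.n) (hCs : ∀ v, v ∈ allv st.n x D ↔ v ∈ Cs)
    (hCn : Cs.Nodup) {a b : ℕ} {p : List ℕ} (hh : ham st (a :: b :: p) = true)
    (hs : second st a b = true) : False := by
  simp only [second, Bool.and_eq_true, List.isEmpty_iff, List.all_eq_true, Option.isNone_iff_eq_none]
    at hs
  obtain ⟨⟨⟨⟨⟨⟨s1, s2⟩, s3⟩, s4⟩, s5⟩, s6⟩, s7⟩ := hs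
  obtain ⟨ha, q, q1, q2, q3, q4⟩ := ham_sound h hh
  obtain ⟨hb, q', rfl⟩ := q4 b p rfl s3
  have hpC : (allv st.n x D).Perm Cs := (List.perm_ext_iff_of_nodup h.nd hCn).2 hCs
  have s2 : 0 < b := Nat.le_of_ble_eq_true s2
  have hemp : ∀ y, G.Adj (x b) y → y ∉ Flist x b D → y ∉ Cs := by
    intro y hy hyF hyC
    obtain ⟨st', hst', -⟩ := targets_sound h hc.nobad hb hy hyF ((hCs y).2 hyC)
    rw [s5] at hst'
    simp at hst'
  refine redu_sound hc (h.complete hb ?_) h0 hn s4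
  intro y hy
  by_contra hyF
  have hyC := hemp y hy hyF
  rcases hc.second _ _ _ q1 (q3.trans hpC) (h0 ▸ q2) y hy with h1 | ⟨s, t1, t2, t3, t4⟩ | ⟨h1, h2⟩
  · exact hyC h1
  · have hk := s6 ((s.length + 1) % 4) (by
      have : (s.length + 1) % 4 < 4 := Nat.mod_lt _ (by norm_num)
      generalize (s.length + 1) % 4 = t at *
      interval_cases t <;> simp)
    refine kill h hc.nobad hb hn (by omega) (Nat.mod_lt _ (by norm_num)) hk s t2 ?_ ?_ rfl
      (fun h => absurd h t1)
    · intro v hv hv'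
      exact t3 v hv ((hCs v).1 hv')
    · rw [h0]; exact t4
  · obtain ⟨hR, hP⟩ := h.newmark hb (fun hm => hyC ((hCs y).1 hm)) hy
    have hxn : Function.update x st.n y st.n = y := Function.update_self ..
    have step : ∀ (st' : St) (x' : ℕ → V) (D' : List (Ent V)), Real G st' x' D' → st.n < st'.n →
        x' st.n = y → (∀ v ∈ Cs, v ∈ allv st'.n x' D') → degL st'.L st.n ≤ 2 →
        ∃ s ∈ targets st' st.n, ∃ x'' D'', Real G s x'' D'' ∧ (∀ j < st'.n, x'' j = x' j) ∧
        st'.n ≤ s.n ∧ ∀ v, v ∈ allv s.n x'' D'' ↔ v ∈ allv st'.n x' D' := by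
      intro st' x' D' hR' hlt hxy hsub hdeg
      obtain ⟨z, hz, hzF⟩ := hc.mindeg y (Flist x' st.n D') (by
        rw [Flist_length, hR'.map]; exact hdeg)
      exact targets_sound hR' hc.nobad hlt (hxy.symm ▸ hz) hzF (hsub z (h2 z hz))
    have hdeg0 : degL ((b, st.n, 5) :: st.L) st.n ≤ 2 := by
      have : degL st.L st.n = 0 := by
        rw [← h.map, ← Flist_length x, List.length_eq_zero_iff, Flist, List.flatMap_eq_nil_iff]
        intro e he
        have := h.ok e he
        rw [List.eq_nil_iff_forall_not_mem]
        intro v hv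
        have h1 := this.ha
        have h2 := this.hb
        rcases mem_Fent.1 hv with ⟨h3, -⟩ | ⟨h3, -⟩ <;> omega
      have e : degL ((b, st.n, 5) :: st.L) st.n = (bif Nat.beq b st.n then 1 else 0) +
        (bif Nat.beq st.n st.n then 1 else 0) + degL st.L st.n := by
        simp [degL]
      rw [e, this]
      cases Nat.beq b st.n <;> cases Nat.beq st.n st.n <;> simp
    obtain ⟨s, hs, x'', D'', hR2, hx2, hn2, hv2⟩ := step _ _ _ hR (by simp) hxn
      (fun v hv => hP.mem_iff.2 (List.mem_cons_of_mem _ ((hCs v).2 hv))) hdeg0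
    have hs7 := s7 s hs
    obtain ⟨s', hs', -⟩ := step s x'' D'' hR2 (lt_of_lt_of_le (by simp) hn2)
      ((hx2 st.n (by simp)).trans hxn)
      (fun v hv => (hv2 v).2 (hP.mem_iff.2 (List.mem_cons_of_mem _ ((hCs v).2 hv))))
      (Nat.le_of_ble_eq_true hs7.1)
    rw [hs7.2] at hs'
    simp at hs'

theorem runAll_some {g : St → List Op → Option (List Op)} {ss : List St} :
    ∀ {h h' : List Op}, runAll g ss h = some h' → ∀ s ∈ ss, ∃ k k', g s k = some k' := by
  induction ss with
  | nil => intro h h' _ s hs; simp at hs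
  | cons s ss ih =>
    intro h h' hr t ht
    rw [runAll] at hr
    cases hg : g s h with
    | none => rw [hg] at hr; simp at hr
    | some k =>
      rw [hg] at hr
      rcases List.mem_cons.1 ht with rfl | ht
      · exact ⟨h, k, hg⟩
      · exact ih hr t ht

theorem chk_sound {Cs : List V} {T : V} (hc : Ctx G Cs T) (hCn : Cs.Nodup) (f : ℕ) :
    ∀ (st : St) (k k' : List Op), chk f st k = some k' → ∀ (x : ℕ → V) (D : List (Ent V)),
    Real G st x D → x 0 = T → 0 < st.n → (∀ v, v ∈ allv st.n x D ↔ v ∈ Cs) → False := by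
  induction f with
  | zero => intro st k k' h; simp [chk] at h
  | succ f ih =>
    intro st k k' hk x D h h0 hn hCs
    have hpC : (allv st.n x D).Perm Cs := (List.perm_ext_iff_of_nodup h.nd hCn).2 hCs
    rw [chk, fN_eq, fL_eq] at hk
    unfold chkStep at hk
    split at hk
    · simp at hk
    · rename_i s h'
      cases hr : redu st s with
      | false =>
        have hr' : redu ⟨st.n, st.L, st.C⟩ s = false := hr
        simp [hr'] at hk
      | true => exact redu_sound hc h h0 hn hr
    · rename_i p h'
      split at hk
      · rename_i a b p
        cases hr : (ham st (a :: b :: p) && second st a b) with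
        | false =>
          have hr' : (ham ⟨st.n, st.L, st.C⟩ (a :: b :: p) && second ⟨st.n, st.L, st.C⟩ a b)
            = false := hr
          rw [hr'] at hk
          simp at hk
        | true =>
          rw [Bool.and_eq_true] at hr
          exact second_sound hc h h0 hn hCs hCn hr.1 hr.2
      · simp at hk
    · rename_i m i h'
      simp only at hk
      split at hk
      · simp at hk
      · rename_i l hl
        cases hb : (Nat.ble 4 l.2.2 || !(Nat.beq l.1 i || Nat.beq l.2.1 i)) with
        | true => rw [hb] at hk; simp at hk
        | false =>
          rw [hb, cond_false] at hk
          have hall := runAll_some hk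
          simp only [Bool.or_eq_false_iff, Bool.not_eq_false', Bool.or_eq_true, Nat.beq_eq] at hb
          obtain ⟨hb1, hb2⟩ := hb
          have hb1 : ¬ 4 ≤ l.2.2 := by
            intro h; rw [Nat.ble_eq_true_of_le h] at hb1; simp at hb1
          rw [← h.map, List.getElem?_map, Option.map_eq_some_iff] at hl
          obtain ⟨e, hem, hel⟩ := hl
          obtain ⟨hm, hme⟩ := List.getElem?_eq_some_iff.1 hem
          have hperm : D.Perm (e :: D.eraseIdx m) := by
            rw [← hme]
            exact (List.getElem_cons_eraseIdx_perm hm).symm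
          have h2 := Real.perm (n := st.n) (L := st.L) (C := st.C) h hperm
          have hLk : st.L.eraseIdx m = (D.eraseIdx m).map Prod.fst := by
            rw [← h.map, List.eraseIdx_map]
          -- orient the entry so that it starts at `i`
          obtain ⟨e', h3, hi, ho, hcc, hav⟩ : ∃ e' : Ent V,
              Real G ⟨st.n, (e' :: D.eraseIdx m).map Prod.fst, st.C⟩ x (e' :: D.eraseIdx m) ∧
              e'.1.1 = i ∧ e'.1.2.1 = (bif Nat.beq l.1 i then l.2.1 else l.1) ∧
              e'.1.2.2 = l.2.2 ∧
              (allv st.n x (e' :: D.eraseIdx m)).Perm (allv st.n x D) := by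
            cases hli : Nat.beq l.1 i with
            | true =>
              exact ⟨e, h2, by rw [hel]; simpa using hli, by rw [hel]; rfl, by rw [hel],
                (allv_perm hperm).symm⟩
            | false =>
              have hli' : l.1 ≠ i := by intro h; simp [h] at hli
              refine ⟨flip e, h2.flipHead, ?_, ?_, ?_, ?_⟩
              · simp only [flip, hel]; exact hb2.resolve_left hli'
              · simp only [flip, hel, cond_false]
              · simp only [flip, hel]
              · exact (allv_flip.symm).trans (allv_perm hperm).symm
          obtain ⟨⟨a, b, c⟩, q⟩ := e'
          simp only at hi ho hcc
          subst hi hcc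
          obtain ⟨ea, eb, eab, ech, elen, eex, ele⟩ := h3.ok _ List.mem_cons_self
          simp only at ea eb eab ech elen eex ele
          cases q with
          | nil =>
            have hc1 : l.2.2 = 1 := by
              simp at elen; omega
            obtain ⟨k1, k2, hk12⟩ := hall ⟨st.n, (a, b, 5) :: st.L.eraseIdx m, st.C⟩ (by
              simp [splitEnd, hc1, ho])
            refine ih _ _ _ hk12 x (((a, b, 5), []) :: D.eraseIdx m) ⟨by simp [hLk], ?_, ?_, ?_⟩ h0
              hn ?_
            · intro e he
              rcases List.mem_cons.1 he with rfl | he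
              · exact ⟨ea, eb, eab, ech, by simp, by simp, by simp⟩
              · exact h3.ok e (List.mem_cons_of_mem _ he)
            · exact h3.nd
            · exact h3.comp
            · intro v
              rw [← hCs, ← hav.mem_iff]
              exact Iff.rfl
          | cons y q =>
            have h4 := Real.split (p := []) (r := 5) (r' := (l.2.2 + 3) % 4) h3 (by simp) (by simp)
              (by simp) (by simp at elen; omega) (by omega) (by omega)
            obtain ⟨k1, k2, hk12⟩ := hall
              ⟨st.n + 1, (a, st.n, 5) :: (st.n, b, (l.2.2 + 3) % 4) :: st.L.eraseIdx m, st.C⟩ (by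
              simp [splitEnd, ho])
            rw [hLk] at hk12
            refine ih _ _ _ hk12 _ _ h4.1 ?_ (by simp) ?_
            · rw [Function.update_of_ne (by omega)]; exact h0
            · intro v
              rw [← hCs, ← hav.mem_iff]
              exact (allv_split (p := []) (l := (a, b, l.2.2))).mem_iff.symm
    · rename_i p h'
      split at hk
      · rename_i a p
        cases hr : ham st (a :: p) with
        | false =>
          have hr' : ham ⟨st.n, st.L, st.C⟩ (a :: p) = false := hr
          rw [hr'] at hk
          simp at hk
        | true =>
          have hr' : ham ⟨st.n, st.L, st.C⟩ (a :: p) = true := hr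
          rw [hr', cond_true] at hk
          have hall := runAll_some hk
          obtain ⟨ha, q, q1, q2, q3, -⟩ := ham_sound h hr
          have hend := hc.endn _ _ q1 (q3.trans hpC) (h0 ▸ q2)
          by_cases hcomp : ∀ y, G.Adj (x a) y → y ∈ Flist x a D
          · have hd : Nat.ble 3 (degL st.L a) = true := by
              apply Nat.ble_eq_true_of_le
              by_contra hlt
              obtain ⟨y, hy, hyF⟩ := hc.mindeg (x a) (Flist x a D) (by
                rw [Flist_length, h.map]; omega)
              exact hyF (hcomp y hy)
            obtain ⟨k1, k2, hk12⟩ := hall ⟨st.n, st.L, a :: st.C⟩ (by simp [hd])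
            exact ih _ _ _ hk12 x D (h.complete ha hcomp) h0 hn hCs
          · push Not at hcomp
            obtain ⟨y, hy, hyF⟩ := hcomp
            obtain ⟨st', hst', x', D', hR, hx, hle, hv⟩ := targets_sound h hc.nobad ha hy hyF
              ((hCs y).2 (hend y hy))
            obtain ⟨k1, k2, hk12⟩ := hall st' (List.mem_append_right _ hst')
            exact ih _ _ _ hk12 x' D' hR ((hx 0 hn).trans h0) (by omega)
              (fun v => (hv v).trans (hCs v))
      · simp at hk

end sound

end C24

namespace C24

section graph

variable {V : Type} {G : SimpleGraph V}

theorem exists_walk (l : List V) : ∀ (a b : V), (a :: (l ++ [b])).IsChain G.Adj →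
    ∃ w : G.Walk a b, w.support = a :: (l ++ [b]) := by
  induction l with
  | nil =>
    intro a b h
    have : G.Adj a b := by simpa using h
    exact ⟨Walk.cons this Walk.nil, by simp⟩
  | cons c l ih =>
    intro a b h
    rw [List.cons_append, List.isChain_cons_cons] at h
    obtain ⟨w, hw⟩ := ih c b h.2
    exact ⟨Walk.cons h.1 w, by simp [hw]⟩

theorem noBad_of_walk (h : ¬ ∃ (u : V) (c : G.Walk u u), c.IsCycle ∧ c.length % 4 = 2) :
    NoBad G := by
  intro a l hnd hch hl hbad
  apply h
  cases l with
  | nil => simp at hl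
  | cons b l =>
    rw [List.cons_append, List.isChain_cons_cons] at hch
    obtain ⟨w, hw⟩ := exists_walk l b a hch.2
    have hlen : w.length = l.length + 1 := by
      have := w.length_support
      rw [hw] at this
      simp at this
      omega
    have hp : w.IsPath := by
      rw [Walk.isPath_def, hw]
      have : (b :: (l ++ [a])).Perm (a :: b :: l) := by
        rw [← List.cons_append]
        exact List.perm_append_singleton a (b :: l)
      exact this.nodup_iff.2 hnd
    refine ⟨a, Walk.cons hch.1 w, ?_, ?_⟩
    · rw [Walk.cons_isCycle_iff]
      refine ⟨hp, fun hm => ?_⟩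
      rw [Sym2.eq_swap] at hm
      have := hp.length_eq_one_of_mem_edges hm
      simp at hl
      omega
    · simp at hbad
      simp [hlen]
      omega

theorem exists_max {P : ℕ → Prop} (B : ℕ) (hB : ∀ n, P n → n ≤ B) (h : ∃ n, P n) :
    ∃ M, P M ∧ ∀ n, P n → n ≤ M := by
  classical
  obtain ⟨n, hn⟩ := h
  exact ⟨Nat.findGreatest P B, Nat.findGreatest_spec (hB n hn) hn,
    fun m hm => Nat.le_findGreatest (hB m hm) hm⟩

/-- A path whose first vertex is adjacent to the end of its initial part `v :: h`. -/
structure Las (G : SimpleGraph V) (M : ℕ) (v : V) (h B : List V) (T : V) : Prop where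
  nd : ((v :: h) ++ B).Nodup
  ch : ((v :: h) ++ B).IsChain G.Adj
  len : ((v :: h) ++ B).length = M
  last : (v :: h).getLast? = some T
  adj : G.Adj v T

theorem Las.app {M : ℕ} {v T : V} {h B : List V} (hl : Las G M v h B T) {P : List V}
    (hP : P.IsChain G.Adj) (hT : P.getLast? = some T) : (P ++ B).IsChain G.Adj := by
  obtain ⟨-, h2, h3⟩ := List.isChain_append.1 hl.ch
  rw [List.isChain_append]
  refine ⟨hP, h2, ?_⟩
  rw [hT, ← hl.last]
  exact h3

theorem Las.extend {M : ℕ} {v T y : V} {h b1 b2 : List V} (hc : ((v :: h) ++ (b1 ++ y :: b2)).IsChain G.Adj)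
    (hn : ((v :: h) ++ (b1 ++ y :: b2)).Nodup)
    (hlen : ((v :: h) ++ (b1 ++ y :: b2)).length = M) (hvy : G.Adj v y) :
    Las G M v (h ++ b1 ++ [y]) b2 y := by
  have e : (v :: (h ++ b1 ++ [y])) ++ b2 = (v :: h) ++ (b1 ++ y :: b2) := by simp
  refine ⟨e ▸ hn, e ▸ hc, e ▸ hlen, ?_, hvy⟩
  rw [← List.cons_append, List.getLast?_concat]

theorem ctx_of {M : ℕ} {v0 T : V} {h0 B : List V} (hl : Las G M v0 h0 B T) (hN : NoBad G)
    (hM : ∀ l : List V, l.Nodup → l.IsChain G.Adj → l.length ≤ M)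
    (hA : ∀ v h B T, Las G M v h B T → (v :: h).length ≤ (v0 :: h0).length)
    (hmin : ∀ (v : V) (F : List V), F.length ≤ 2 → ∃ y, G.Adj v y ∧ y ∉ F)
    (hred : ∀ S : List V, S ≠ [] → S.Nodup → T ∉ S → ∀ Es : List (Sym2 V),
    (∀ v ∈ S, ∀ y, G.Adj v y → s(v, y) ∈ Es) → 5 * S.length < 2 * Es.length) :
    Ctx G (v0 :: h0) T := by
  have hlenB : (v0 :: h0).length + B.length = M := by rw [← hl.len, List.length_append]
  refine ⟨hN, hmin, ?_, ?_, hred⟩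
  · intro v h hc hp hT y hy
    by_contra hyA
    have c1 := hl.app hc hT
    have p1 : ((v :: h) ++ B).Perm ((v0 :: h0) ++ B) := List.Perm.append_right _ hp
    have n1 := p1.nodup_iff.2 hl.nd
    have l1 := p1.length_eq.trans hl.len
    by_cases hyB : y ∈ B
    · obtain ⟨b1, b2, rfl⟩ := List.append_of_mem hyB
      have := hA _ _ _ _ (Las.extend (T := T) c1 n1 l1 hy)
      have := hp.length_eq
      simp at *
      omega
    · have hyn : y ∉ (v :: h) ++ B := by
        rw [List.mem_append, hp.mem_iff]
        tauto
      have := hM (y :: ((v :: h) ++ B)) (List.nodup_cons.2 ⟨hyn, n1⟩)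
        (List.IsChain.cons_cons hy.symm c1)
      simp only [List.length_cons] at this l1
      omega
  · intro v v1 h hc hp hT y hy
    by_cases hyA : y ∈ v0 :: h0
    · exact Or.inl hyA
    right
    by_cases hyB : y ∈ B
    · left
      obtain ⟨b1, b2, rfl⟩ := List.append_of_mem hyB
      obtain ⟨n1, n2, n3⟩ := List.nodup_append.1 hl.nd
      obtain ⟨d1, d2, d3⟩ := List.isChain_append.1 hl.ch
      have hTB : (T :: (b1 ++ y :: b2)).IsChain G.Adj := by
        rw [List.isChain_cons]
        exact ⟨d3 T hl.last, d2⟩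
      refine ⟨b1 ++ [y], by simp, ?_, ?_, ?_⟩
      · have : (b1 ++ [y]).Sublist (b1 ++ y :: b2) := by simp
        exact n2.sublist this
      · intro w hw hw'
        refine n3 w hw' w ?_ rfl
        simp at hw ⊢
        tauto
      · have e1 : T :: (b1 ++ [y] ++ [v1]) = (T :: b1) ++ y :: [v1] := by simp
        have e2 : T :: (b1 ++ y :: b2) = (T :: b1) ++ y :: b2 := by simp
        rw [e2, List.isChain_split] at hTB
        rw [e1, List.isChain_split]
        exact ⟨hTB.1, by simpa using hy.symm⟩
    · right
      refine ⟨hyA, fun z hz => ?_⟩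
      by_contra hzA
      have hc2 := hc.of_cons
      have hT2 : (v1 :: h).getLast? = some T := by rwa [List.getLast?_cons_cons] at hT
      have hc3 : (y :: v1 :: h).IsChain G.Adj := List.IsChain.cons_cons hy.symm hc2
      have hT3 : (y :: v1 :: h).getLast? = some T := by rwa [List.getLast?_cons_cons]
      have c1 := hl.app hc3 hT3
      have p1 : ((v :: v1 :: h) ++ B).Perm ((v0 :: h0) ++ B) := List.Perm.append_right _ hp
      have n0 := p1.nodup_iff.2 hl.nd
      have hsub : ∀ w ∈ v1 :: h, w ∈ v0 :: h0 := fun w hw => hp.mem_iff.1 (List.mem_cons_of_mem _ hw)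
      have n1 : ((y :: v1 :: h) ++ B).Nodup := by
        rw [List.cons_append, List.nodup_cons] at n0 ⊢
        refine ⟨?_, n0.2⟩
        rw [List.mem_append]
        rintro (h | h)
        · exact hyA (hsub y h)
        · exact hyB h
      have l1 : ((y :: v1 :: h) ++ B).length = M := p1.length_eq.trans hl.len
      by_cases hzB : z ∈ B
      · obtain ⟨b1, b2, rfl⟩ := List.append_of_mem hzB
        have := hA _ _ _ _ (Las.extend (T := T) c1 n1 l1 hz)
        have := hp.length_eq
        simp at *
        omega
      · have hzn : z ∉ (y :: v1 :: h) ++ B := by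
          rw [List.mem_append]
          rintro (h | h)
          · rcases List.mem_cons.1 h with rfl | h
            · exact hz.ne rfl
            · exact hzA (hsub z h)
          · exact hzB h
        have := hM (z :: ((y :: v1 :: h) ++ B)) (List.nodup_cons.2 ⟨hzn, n1⟩)
          (List.IsChain.cons_cons hz.symm c1)
        simp only [List.length_cons] at this l1
        omega

theorem start_contra (H : ∀ g, 1 ≤ g → g ≤ 3 → ∃ k k', chk 60 (start g) k = some k')
    {M : ℕ} {v T : V} {h B : List V} (hl : Las G M v h B T) (hc : Ctx G (v :: h) T) : False := by
  obtain ⟨nA, -, -⟩ := List.nodup_append.1 hl.nd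
  obtain ⟨cA, -, -⟩ := List.isChain_append.1 hl.ch
  have hend := hc.endn v h cA (List.Perm.refl _) hl.last
  -- shape of the cycle
  obtain ⟨mid, u, rfl⟩ : ∃ mid u, h = mid ++ [u, T] := by
    have hlast := hl.last
    rcases List.eq_nil_or_concat h with rfl | ⟨h1, t, rfl⟩
    · simp at hlast
      exact absurd hlast (hl.adj.ne)
    · have ht : t = T := by
        rw [List.concat_eq_append, ← List.cons_append, List.getLast?_concat] at hlast
        simpa using hlast
      subst ht
      rcases List.eq_nil_or_concat h1 with rfl | ⟨mid, u, rfl⟩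
      · obtain ⟨y, hy, hyF⟩ := hc.mindeg v [v, t] (by simp)
        exact absurd (hend y hy) (by simpa using hyF)
      · exact ⟨mid, u, by simp⟩
  have e1 : v :: (mid ++ [u, T]) = (v :: mid) ++ u :: [T] := by simp
  have hch := cA
  rw [e1, List.isChain_split] at hch
  obtain ⟨c1, c2⟩ := hch
  have c2 : G.Adj u T := by simpa using c2
  have hg0 : (mid.length + 1) % 4 ≠ 0 := by
    intro h0
    refine hc.nobad v (mid ++ [u, T]) nA ?_ (by simp) (by simp; omega)
    have : v :: (mid ++ [u, T] ++ [v]) = (v :: (mid ++ [u])) ++ T :: [v] := by simp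
    rw [this, List.isChain_split]
    refine ⟨by simpa using cA, by simpa using hl.adj.symm⟩
  obtain ⟨k, k', hk⟩ := H ((mid.length + 1) % 4) (by omega) (by omega)
  set x : ℕ → V := fun i => if i = 0 then T else if i = 1 then v else u with hx
  have x0 : x 0 = T := by simp [hx]
  have x1 : x 1 = v := by simp [hx]
  have x2 : x 2 = u := by simp [hx]
  set D : List (Ent V) := [((0, 1, 5), []), ((1, 2, (mid.length + 1) % 4), mid), ((0, 2, 5), [])]
    with hD
  have hperm : (allv 3 x D).Perm (v :: (mid ++ [u, T])) := by
    have : allv 3 x D = [T, v, u] ++ mid := by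
      simp [allv, hD, List.range_succ, x0, x1, x2]
    rw [this]
    have e2 : v :: (mid ++ [u, T]) = [v] ++ (mid ++ [u, T]) := rfl
    rw [e2]
    have s1 : ([T, v, u] ++ mid).Perm ([v, u, T] ++ mid) :=
      List.Perm.append_right _ (by
        have : ([T] ++ [v, u]).Perm ([v, u] ++ [T]) := List.perm_append_comm
        simpa using this)
    refine s1.trans ?_
    refine List.Perm.cons v ?_
    exact List.perm_append_comm (l₁ := [u, T])
  have hR : Real G (start ((mid.length + 1) % 4)) x D := by
    refine ⟨rfl, ?_, hperm.nodup_iff.2 nA, by simp [start]⟩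
    intro e he
    simp only [hD, List.mem_cons, List.not_mem_nil, or_false] at he
    rcases he with rfl | rfl | rfl
    · exact ⟨by simp [start], by simp [start], by simp, by simpa [x0, x1] using hl.adj.symm,
        by simp, by simp, by simp⟩
    · exact ⟨by simp [start], by simp [start], by simp, by simpa [x1, x2] using c1,
        by simp, by simp; omega, by simp; omega⟩
    · exact ⟨by simp [start], by simp [start], by simp, by simpa [x0, x2] using c2.symm,
        by simp, by simp, by simp⟩
  exact chk_sound hc nA 60 _ _ _ hk x D hR x0 (by simp [start]) (fun w => hperm.mem_iff)

theorem no_graph (H : ∀ g, 1 ≤ g → g ≤ 3 → ∃ k k', chk 60 (start g) k = some k')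
    [Fintype V] [Nontrivial V] (hN : NoBad G)
    (hred : ∀ S : List V, S ≠ [] → S.Nodup → (∃ t, t ∉ S) → ∀ Es : List (Sym2 V),
    (∀ v ∈ S, ∀ y, G.Adj v y → s(v, y) ∈ Es) → 5 * S.length < 2 * Es.length) : False := by
  have hmin : ∀ (v : V) (F : List V), F.length ≤ 2 → ∃ y, G.Adj v y ∧ y ∉ F := by
    intro v F hF
    by_contra hcon
    push Not at hcon
    obtain ⟨t, ht⟩ := exists_ne v
    have := hred [v] (by simp) (by simp) ⟨t, by simpa using ht⟩ (F.map fun y => s(v, y)) (by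
      intro w hw y hy
      rw [List.mem_singleton] at hw
      subst hw
      exact List.mem_map.2 ⟨y, hcon y hy, rfl⟩)
    simp at this
    omega
  obtain ⟨M, ⟨l, ln, lc, ll⟩, hM⟩ := exists_max
    (P := fun n => ∃ l : List V, l.Nodup ∧ l.IsChain G.Adj ∧ l.length = n) (Fintype.card V) (by
      rintro n ⟨l, h1, -, rfl⟩
      exact h1.length_le_card) ⟨0, [], by simp⟩
  have hM : ∀ l : List V, l.Nodup → l.IsChain G.Adj → l.length ≤ M :=
    fun l h1 h2 => hM _ ⟨l, h1, h2, rfl⟩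
  obtain ⟨m, ⟨v, h, B, T, hl, hlm⟩, hA⟩ := exists_max
    (P := fun m => ∃ v h B T, Las G M v h B T ∧ (v :: h).length = m) M (by
      rintro n ⟨v, h, B, T, hl, rfl⟩
      rw [← hl.len, List.length_append]
      omega) (by
      obtain ⟨a, -⟩ := exists_pair_ne V
      cases l with
      | nil =>
        have := hM [a] (by simp) (by simp)
        simp at this ll
        omega
      | cons v l =>
        obtain ⟨y, hy, -⟩ := hmin v [] (by simp)
        have hyl : y ∈ l := by
          by_contra hyl
          have := hM (y :: v :: l) (List.nodup_cons.2 ⟨by simp [hyl, hy.ne.symm], ln⟩)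
            (List.IsChain.cons_cons hy.symm lc)
          simp at this ll
          omega
        obtain ⟨b1, b2, rfl⟩ := List.append_of_mem hyl
        exact ⟨_, v, [] ++ b1 ++ [y], b2, y, Las.extend (T := v) (h := []) lc ln ll hy, rfl⟩)
  have hc := ctx_of hl hN hM (fun v h B T hl' => by
    rw [hlm]; exact hA _ ⟨v, h, B, T, hl', rfl⟩) hmin
    (fun S h1 h2 h3 => hred S h1 h2 ⟨T, h3⟩)
  exact start_contra H hl hc

theorem bound (H : ∀ g, 1 ≤ g → g ≤ 3 → ∃ k k', chk 60 (start g) k = some k') (n : ℕ) :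
    ∀ (V : Type) [Fintype V] (G : SimpleGraph V), Fintype.card V = n → 1 ≤ n → NoBad G →
    2 * G.edgeSet.ncard ≤ 5 * (n - 1) := by
  classical
  induction n using Nat.strong_induction_on with
  | _ n ih =>
    intro V _ G hcard hn hN
    by_contra hcon
    push Not at hcon
    have hnt : Nontrivial V := by
      rw [← Fintype.one_lt_card_iff_nontrivial, hcard]
      by_contra h1
      have hss : Subsingleton V := by
        rw [← Fintype.card_le_one_iff_subsingleton]; omega
      have : G.edgeSet = ∅ := by
        rw [Set.eq_empty_iff_forall_notMem]
        intro e
        induction e with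
        | _ a b =>
          intro he
          exact (G.ne_of_adj he) (Subsingleton.elim a b)
      rw [this] at hcon
      simp at hcon
    refine no_graph H hN ?_
    intro S hS hSn ⟨t, ht⟩ Es hEs
    by_contra hle
    push Not at hle
    let G' : SimpleGraph {v // v ∉ S} := G.comap Subtype.val
    have hSl : 0 < S.length := List.length_pos_iff.2 hS
    have hc' : Fintype.card {v // v ∉ S} = n - S.length := by
      have := Fintype.card_subtype_compl (fun v => v ∈ S)
      rw [this, hcard]
      congr 1
      have := Fintype.card_of_subtype (p := fun v => v ∈ S) S.toFinset (by simp)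
      rw [this, List.toFinset_card_of_nodup hSn]
    have hpos : 0 < Fintype.card {v // v ∉ S} := Fintype.card_pos_iff.2 ⟨⟨t, ht⟩⟩
    have hN' : NoBad G' := by
      intro a l h1 h2 h3
      have := hN a.1 (l.map Subtype.val) (by
        have := h1.map Subtype.val_injective
        simpa using this) (by
        have h2' : (List.map Subtype.val (a :: (l ++ [a]))).IsChain G.Adj := by
          rw [List.isChain_map]
          exact h2
        simpa using h2') (by simpa using h3)
      simpa using this
    have hb := ih _ (by omega) {v // v ∉ S} G' hc' (by omega) hN'
    have hsub : G.edgeSet ⊆ (↑Es.toFinset : Set (Sym2 V)) ∪ Set.image (Sym2.map Subtype.val) G'.edgeSet := by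
      intro e
      induction e with
      | _ a b =>
        intro he
        have he : G.Adj a b := he
        by_cases ha : a ∈ S
        · left; simpa using hEs a ha b he
        by_cases hb : b ∈ S
        · left
          have := hEs b hb a he.symm
          rw [Sym2.eq_swap] at this
          simpa using this
        · right
          exact ⟨s(⟨a, ha⟩, ⟨b, hb⟩), he, by simp⟩
    have h1 : G.edgeSet.ncard ≤ Es.length + G'.edgeSet.ncard := by
      refine (Set.ncard_le_ncard hsub (Set.toFinite _)).trans ?_
      refine (Set.ncard_union_le _ _).trans ?_
      refine Nat.add_le_add ?_ (Set.ncard_image_le (Set.toFinite _))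
      rw [Set.ncard_coe_finset]
      exact List.toFinset_card_le _
    omega

end graph

end C24

namespace C24

/-- `k` copies of `K_5` glued at one vertex. -/
def windmill (k : ℕ) : SimpleGraph (Option (Fin k × Fin 4)) where
  Adj u v := u ≠ v ∧ ∀ p q, u = some p → v = some q → p.1 = q.1
  symm := ⟨fun _ _ h => ⟨h.1.symm, fun p q hp hq => (h.2 q p hq hp).symm⟩⟩
  loopless := ⟨fun _ h => h.1 rfl⟩

theorem windmill_adj {k : ℕ} {u v : Option (Fin k × Fin 4)} : (windmill k).Adj u v ↔
    u ≠ v ∧ ∀ p q, u = some p → v = some q → p.1 = q.1 := Iff.rfl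

theorem windmill_path {k : ℕ} {u v : Option (Fin k × Fin 4)} (p : (windmill k).Walk u v) :
    p.IsPath → (none ∈ p.support → v = none) → ∀ a : Fin k, (∀ w, u = some w → w.1 = a) →
    ∀ q, some q ∈ p.support → q.1 = a := by
  induction p with
  | nil =>
    intro _ _ a ha q hq
    simp only [Walk.support_nil, List.mem_singleton] at hq
    exact ha q hq.symm
  | @cons u w v h p ih =>
    intro hp hn a ha q hq
    rw [Walk.cons_isPath_iff] at hp
    cases u with
    | none =>
      have hv := hn (by simp)
      subst hv
      exact absurd p.end_mem_support hp.2
    | some u =>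
      rw [Walk.support_cons, List.mem_cons] at hq
      rcases hq with hq | hq
      · exact ha q hq.symm
      · refine ih hp.1 (fun hm => hn (by simp [hm])) a ?_ q hq
        rintro w rfl
        rw [← ha u rfl]
        exact (h.2 u w rfl rfl).symm

theorem windmill_cycle {k : ℕ} {u : Option (Fin k × Fin 4)} (c : (windmill k).Walk u u)
    (hc : c.IsCycle) (hu : none ∈ c.support → u = none) : c.length ≤ 5 := by
  classical
  cases c with
  | nil => simp
  | @cons _ w _ h p =>
    have hp := ((Walk.cons_isCycle_iff p h).1 hc).1
    cases w with
    | none =>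
      have : u = none := hu (by simp)
      subst this
      exact absurd h (windmill k).irrefl
    | some w =>
      have hall := windmill_path p hp (fun hm => hu (by simp [hm])) w.1 (by
        rintro w' hw; simp only [Option.some.injEq] at hw; rw [hw])
      have hsub : p.support.toFinset ⊆
          insert none ((Finset.univ : Finset (Fin 4)).image fun j => some (w.1, j)) := by
        intro z hz
        rw [List.mem_toFinset] at hz
        cases z with
        | none => simp
        | some q =>
          have := hall q hz
          simp only [Finset.mem_insert, reduceCtorEq, Finset.mem_image, Finset.mem_univ, true_and,
            Option.some.injEq, false_or]
          exact ⟨q.2, by rw [← this]⟩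
      have h1 := Finset.card_le_card hsub
      rw [List.toFinset_card_of_nodup hp.support_nodup, Walk.length_support] at h1
      have h2 := Finset.card_insert_le (none : Option (Fin k × Fin 4))
        ((Finset.univ : Finset (Fin 4)).image fun j => some (w.1, j))
      have h3 := Finset.card_image_le (s := (Finset.univ : Finset (Fin 4)))
        (f := fun j => (some (w.1, j) : Option (Fin k × Fin 4)))
      simp only [Finset.card_univ, Fintype.card_fin] at h3
      rw [Walk.length_cons]
      omega

theorem windmill_good {k : ℕ} {u : Option (Fin k × Fin 4)} (c : (windmill k).Walk u u)
    (hc : c.IsCycle) : c.length % 4 ≠ 2 := by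
  classical
  have h3 := hc.three_le_length
  have h5 : c.length ≤ 5 := by
    by_cases hn : none ∈ c.support
    · rw [← Walk.length_rotate c none hn]
      exact windmill_cycle _ (hc.rotate hn) (fun _ => rfl)
    · exact windmill_cycle c hc (fun h => absurd h hn)
  omega

theorem windmill_edges (k : ℕ) : 2 * (windmill k).edgeSet.ncard = 5 * (4 * k) := by
  classical
  have h := (windmill k).sum_degrees_eq_twice_card_edges
  have h0 : (windmill k).degree none = k * 4 := by
    have : (windmill k).neighborFinset none = Finset.univ.map Function.Embedding.some := by
      ext z
      cases z <;> simp [windmill_adj]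
    rw [← card_neighborFinset_eq_degree, this]
    simp
  have h1 : ∀ p, (windmill k).degree (some p) = 4 := by
    intro p
    have : (windmill k).neighborFinset (some p) =
        insert none ((Finset.univ.erase p.2).image fun j => some (p.1, j)) := by
      ext z
      cases z with
      | none => simp [windmill_adj]
      | some q =>
        obtain ⟨a, i⟩ := p
        obtain ⟨b, j⟩ := q
        simp only [mem_neighborFinset, windmill_adj, Finset.mem_insert, Finset.mem_image,
          Finset.mem_erase, Finset.mem_univ, Option.some.injEq, Prod.mk.injEq, reduceCtorEq,
          false_or, and_true, ne_eq]
        constructor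
        · rintro ⟨h1, h2⟩
          have := h2 _ _ rfl rfl
          simp only at this
          subst this
          exact ⟨j, fun h => h1 ⟨rfl, h.symm⟩, rfl, rfl⟩
        · rintro ⟨j', h1, rfl, rfl⟩
          refine ⟨fun h => h1 h.2.symm, ?_⟩
          rintro p q rfl rfl
          rfl
    rw [← card_neighborFinset_eq_degree, this, Finset.card_insert_of_notMem (by simp),
      Finset.card_image_of_injective _ (by intro a b h; simpa using h),
      Finset.card_erase_of_mem (Finset.mem_univ _)]
    simp
  rw [Fintype.sum_option, h0] at h
  simp only [h1, Finset.sum_const, Finset.card_univ, Fintype.card_prod, Fintype.card_fin,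
    smul_eq_mul] at h
  rw [← coe_edgeFinset, Set.ncard_coe_finset, ← h]
  omega

theorem extremal (N : ℕ) : ∃ n : ℕ, N ≤ n ∧ ∃ G : SimpleGraph (Fin n),
      2 * G.edgeSet.ncard = 5 * (n - 1) ∧
      ∀ (u : Fin n) (c : G.Walk u u), c.IsCycle → c.length % 4 ≠ 2 := by
  classical
  refine ⟨4 * N + 1, by omega, ?_⟩
  have hcard : Fintype.card (Option (Fin N × Fin 4)) = 4 * N + 1 := by
    simp [Fintype.card_option, mul_comm]
  let e : Fin (4 * N + 1) ≃ Option (Fin N × Fin 4) := (Fintype.equivFinOfCardEq hcard).symm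
  let f : (windmill N).comap e ≃g windmill N := SimpleGraph.Iso.comap e (windmill N)
  refine ⟨(windmill N).comap e, ?_, ?_⟩
  · have h := windmill_edges N
    have h2 := f.card_edgeFinset_eq
    rw [← coe_edgeFinset, Set.ncard_coe_finset] at h ⊢
    rw [h2, h]
    simp
  · intro u c hc
    have := windmill_good (c.map f.toHom) (hc.map f.injective)
    simpa using this

end C24

namespace C24

def hint1 : List Op :=
  [.N [1,2,0], .N [1,3,2,0], .S 1 3, .N [4,1,3,2,0],
   .N [4,1,3,2,0], .N [2,3,1,4,0], .N [2,5,3,1,4,0], .S 5 1,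
   .X [1,6,4,3,5,2,0], .N [4,5,1,3,2,0], .N [2,3,1,5,4,0], .N [4,1,3,5,2,0],
   .S 5 1, .X [1,6,4,3,5,2,0], .N [4,5,1,3,2,0], .S 1 5,
   .N [6,4,5,1,3,2,0], .N [6,4,5,1,3,2,0], .S 2 4, .X [4,7,6,5,1,3,2,0],
   .N [6,4,5,1,3,7,2,0], .S 4 4, .X [4,8,6,5,1,3,7,2,0], .N [4,5,1,3,2,0],
   .N [2,3,1,5,4,0], .N [4,5,1,3,6,2,0], .S 1 6, .N [7,3,1,5,4,6,2,0],
   .N [4,1,3,5,2,0], .N [2,5,3,4,1,0], .N [2,5,3,4,6,1,0], .S 5 2,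
   .X [2,7,5,3,4,6,1,0], .N [4,1,3,6,5,2,0], .S 6 1, .X [1,7,4,3,6,5,2,0],
   .N [4,1,3,5,6,2,0], .S 6 1, .X [1,7,4,3,5,6,2,0], .N [4,6,1,3,5,2,0],
   .S 4 5, .N [7,3,1,6,4,5,2,0], .N [4,1,3,5,2,0], .N [2,5,3,4,1,0],
   .N [2,6,5,3,4,1,0], .S 6 1, .X [1,7,4,3,5,6,2,0], .N [4,1,3,5,2,0],
   .S 5 1, .X [1,6,4,3,5,2,0], .N [4,1,3,6,5,2,0], .S 6 1,
   .X [1,7,4,3,6,5,2,0], .N [4,1,3,5,6,2,0], .S 6 1, .X [1,7,4,3,5,6,2,0],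
   .N [1,4,3,2,0], .N [2,3,4,1,0], .N [1,3,4,2,0], .N [2,4,3,1,0],
   .N [1,3,2,0], .N [2,3,1,0], .N [2,4,3,1,0], .S 2 4,
   .N [5,2,4,3,1,0], .N [5,2,4,3,1,0], .S 2 2, .X [2,6,5,4,3,1,0],
   .N [1,4,3,2,0], .N [2,3,4,1,0], .N [1,3,4,2,0], .N [2,4,3,1,0]]

def hint2 : List Op :=
  [.N [2,1,0], .N [2,1,0], .N [1,2,0], .R [1,2],
   .N [1,3,2,0], .S 1 1, .N [4,3,2,1,0], .N [4,3,5,2,1,0],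
   .S 4 4, .X [4,6,3,5,2,1,0], .N [2,3,1,0], .S 2 3,
   .N [4,2,3,1,0], .N [4,2,3,5,1,0], .S 4 4, .X [4,6,2,3,5,1,0],
   .N [2,3,1,0], .N [1,3,2,0], .N [1,3,2,0], .S 2 3,
   .N [4,1,3,2,0], .N [4,1,3,2,0], .S 2 1, .X [1,5,4,3,2,0],
   .N [1,4,3,2,0], .S 1 4, .N [5,1,4,3,2,0], .N [5,1,4,3,2,0],
   .S 2 1, .X [1,6,5,4,3,2,0], .N [5,1,4,6,3,2,0], .S 4 1,
   .X [1,7,5,4,6,3,2,0], .N [1,3,4,2,0], .S 1 3, .N [5,4,2,3,1,0],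
   .N [5,4,6,2,3,1,0], .S 4 5, .X [5,7,4,6,2,3,1,0], .N [5,4,6,2,3,7,1,0],
   .S 1 1, .X [1,8,7,3,5,4,6,2,0], .N [5,4,2,3,6,1,0], .S 4 5,
   .X [5,7,4,2,3,6,1,0], .N [5,4,7,2,3,6,1,0], .S 4 1, .X [1,8,6,3,5,4,7,2,0],
   .N [2,3,4,1,0], .N [1,4,3,2,0], .N [2,4,3,1,0], .N [1,3,4,2,0],
   .N [2,3,1,0], .N [1,3,2,0], .N [1,3,2,0], .S 3 3,
   .N [4,2,3,1,0], .N [4,2,3,1,0], .S 2 2, .X [2,5,4,3,1,0],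
   .N [1,4,3,2,0], .S 4 3, .N [5,2,3,4,1,0], .N [5,2,3,4,1,0],
   .S 2 2, .X [2,6,5,3,4,1,0], .N [5,2,3,6,4,1,0], .S 4 2,
   .X [2,7,5,3,6,4,1,0], .N [1,3,4,2,0], .S 1 3, .N [5,4,2,3,1,0],
   .N [5,4,6,2,3,1,0], .S 4 5, .X [5,7,4,6,2,3,1,0], .N [5,4,6,2,3,7,1,0],
   .S 1 1, .X [1,8,7,3,5,4,6,2,0], .N [5,4,2,3,6,1,0], .S 4 5,
   .X [5,7,4,2,3,6,1,0], .N [5,4,7,2,3,6,1,0], .S 4 1, .X [1,8,6,3,5,4,7,2,0],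
   .N [2,3,1,0], .S 3 3, .N [4,2,3,1,0], .N [4,2,3,5,1,0],
   .S 4 4, .X [4,6,2,3,5,1,0], .N [2,3,4,1,0], .N [1,4,3,2,0],
   .N [2,4,3,1,0], .N [1,3,4,2,0]]

def hint3 : List Op :=
  [.N [1,2,0], .N [1,2,0], .N [2,1,0], .R [1,2],
   .N [2,3,1,0], .S 1 1, .N [4,3,2,1,0], .N [4,3,2,1,0],
   .R [1,4], .N [3,2,1,0], .R [1,3], .N [3,2,1,0],
   .S 3 3, .N [4,2,1,3,0], .N [4,2,1,3,0], .R [1,2,3,4],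
   .N [1,3,2,0], .S 2 2, .N [4,3,1,2,0], .N [4,3,1,2,0],
   .N [2,1,3,4,0], .R [2,4], .N [3,1,2,0], .N [2,3,1,0],
   .R [2,3], .N [2,3,4,1,0], .S 1 1, .N [5,4,3,2,1,0],
   .N [4,3,2,1,0], .R [1,2,3,4], .N [4,3,2,1,0], .R [1,2,3,4],
   .N [3,1,2,0], .N [2,1,3,0], .S 3 3, .N [4,1,2,3,0],
   .N [4,1,2,3,0], .R [1,2,3,4], .N [2,1,4,3,0], .S 1 4,
   .N [5,1,2,4,3,0], .S 2 3, .N [5,4,1,2,3,0], .N [4,1,2,3,0],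
   .R [1,2,3,4], .N [4,1,2,3,0], .R [1,2,3,4], .N [1,3,2,0],
   .N [2,3,1,0], .N [2,3,4,1,0], .S 2 4, .N [5,3,2,4,1,0],
   .N [5,6,3,2,4,1,0], .S 1 6, .N [7,5,6,3,2,4,1,0], .N [7,5,6,3,2,4,1,0],
   .S 2 5, .X [5,8,7,6,3,2,4,1,0], .N [7,5,6,3,2,4,8,1,0], .S 1 1,
   .X [1,9,8,4,5,7,6,3,2,0], .X [1,8,4,5,7,6,3,2,0], .N [5,6,3,2,4,7,1,0], .S 1 1,
   .X [1,8,7,4,5,6,3,2,0], .N [5,3,2,4,6,1,0], .S 1 1, .X [1,7,6,4,5,3,2,0],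
   .N [5,7,3,2,4,6,1,0], .S 4 1, .X [1,8,6,4,5,7,3,2,0], .N [3,2,4,1,0],
   .R [1,3], .N [3,2,4,1,0], .S 3 1, .N [5,4,2,3,1,0],
   .N [4,2,3,1,0], .R [1,4], .N [4,2,3,1,0], .R [1,2,3,4],
   .N [3,2,4,5,1,0], .S 1 1, .X [1,6,5,4,3,2,0], .N [2,4,3,1,0],
   .S 2 4, .N [5,2,4,3,1,0], .N [5,2,4,3,1,0], .S 2 2,
   .X [2,6,5,4,3,1,0], .X [2,5,4,3,1,0], .N [5,2,4,6,3,1,0], .S 4 2,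
   .X [2,7,5,4,6,3,1,0], .X [2,5,4,6,3,1,0], .N [1,3,2,0], .S 3 2,
   .N [4,3,1,2,0], .N [4,3,1,2,0], .N [2,1,3,4,0], .R [2,4],
   .N [3,1,2,0], .N [2,3,1,0], .R [2,3], .N [2,3,4,1,0],
   .S 1 1, .N [5,4,3,2,1,0], .N [4,3,2,1,0], .R [1,2,3,4],
   .N [4,3,2,1,0], .R [1,2,3,4], .N [3,1,2,0], .N [2,1,3,0],
   .S 4 3, .N [4,1,2,3,0], .N [4,1,2,3,0], .R [1,2,3,4],
   .N [2,1,4,3,0], .S 1 4, .N [5,1,2,4,3,0], .S 2 3,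
   .N [5,4,1,2,3,0], .N [4,1,2,3,0], .R [1,2,3,4], .N [4,1,2,3,0],
   .R [1,2,3,4], .N [1,4,3,2,0], .N [2,3,4,1,0], .N [1,3,4,2,0],
   .N [2,4,3,1,0], .N [1,3,2,0], .N [2,3,1,0], .N [2,4,3,1,0],
   .S 2 4, .N [5,2,4,3,1,0], .N [5,2,4,3,1,0], .S 2 2,
   .X [2,6,5,4,3,1,0], .N [1,4,3,2,0], .N [2,3,4,1,0], .N [1,3,4,2,0],
   .N [2,4,3,1,0]]

def okk (g : ℕ) (h : List Op) : Bool := (chk 60 (start g) h).isSome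

theorem ok1 : okk 1 hint1 = true := by decide +kernel
theorem ok2 : okk 2 hint2 = true := by decide +kernel
theorem ok3 : okk 3 hint3 = true := by decide +kernel

theorem hints_ok : ∀ g, 1 ≤ g → g ≤ 3 → ∃ k k', chk 60 (start g) k = some k' := by
  intro g h1 h3
  have key : ∀ g k, okk g k = true → ∃ k k', chk 60 (start g) k = some k' :=
    fun g k h => ⟨k, Option.isSome_iff_exists.1 h⟩
  obtain rfl | rfl | rfl : g = 1 ∨ g = 2 ∨ g = 3 := by omega
  · exact key _ _ ok1
  · exact key _ _ ok2
  · exact key _ _ ok3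

end C24

/-- `c_{2,4} = 5/2`: every `n`-vertex graph with at least `(5/2)(n-1) + 1` edges
contains a cycle of length `≡ 2 (mod 4)`, and for infinitely many `n` there are
`n`-vertex graphs with `(5/2)(n-1)` edges and no such cycle. -/
theorem stmt_10 :
    (∀ (V : Type) [Fintype V] (G : SimpleGraph V),
      5 * (Fintype.card V - 1) + 2 ≤ 2 * G.edgeSet.ncard →
      ∃ (u : V) (c : G.Walk u u), c.IsCycle ∧ c.length % 4 = 2) ∧
    (∀ N : ℕ, ∃ n : ℕ, N ≤ n ∧ ∃ G : SimpleGraph (Fin n),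
      2 * G.edgeSet.ncard = 5 * (n - 1) ∧
      ∀ (u : Fin n) (c : G.Walk u u), c.IsCycle → c.length % 4 ≠ 2) := by
  refine ⟨?_, C24.extremal⟩
  intro V _ G hE
  by_contra hcon
  have hno := C24.noBad_of_walk hcon
  rcases Nat.eq_zero_or_pos (Fintype.card V) with h0 | h0
  · have := Fintype.card_eq_zero_iff.1 h0
    have : G.edgeSet = ∅ := by
      ext e
      induction e with
      | _ x y => exact isEmptyElim x
    rw [this, Set.ncard_empty] at hE
    omega
  · have := C24.bound C24.hints_ok _ V G rfl h0 hno
    omega
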